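/- Let 𝓜 ⊆ 𝒲 be a set of periodic waves such that the image τ(𝓜) is a connected subset of C([0, L], ℝ⁷). Suppose 𝓜 contains at least one trivial wave and that every wave in 𝓜 satisfies g − γ(0)·u(L, η(L)) > 0 (that is, g − γu > 0 at the trough). Then for every wave in 𝓜 and every point of the closure of Ω one has |v| < |u|; in other words, the slope |v/u| of every streamline of every wave in 𝓜 is strictly less than 1. -/

import Mathlib

open Set

/-- Partial derivative in the horizontal direction. -/
noncomputable def pdX (f : ℝ × ℝ → ℝ) (p : ℝ × ℝ) : ℝ := fderiv ℝ f p (1, 0)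

/-- Partial derivative in the vertical direction. -/
noncomputable def pdY (f : ℝ × ℝ → ℝ) (p : ℝ × ℝ) : ℝ := fderiv ℝ f p (0, 1)

/-- A symmetric `2L`-periodic steady gravity water wave with vorticity, in the frame
moving with the wave.  The fluid occupies `Ω = {(x,y) : -L < x < L, -d < y < η x}`;
`u, v` are the relative velocity components, `P` is the pressure, `η` the surface
profile, `ψ` the stream function and `γ` the vorticity function. -/
structure PeriodicWave (g Patm L : ℝ) : Type where
  u : ℝ × ℝ → ℝ
  v : ℝ × ℝ → ℝ
  P : ℝ × ℝ → ℝ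
  η : ℝ → ℝ
  ψ : ℝ × ℝ → ℝ
  γ : ℝ → ℝ
  d : ℝ
  m : ℝ
  d_pos : 0 < d
  m_pos : 0 < m
  u_smooth : ContDiff ℝ 3 u
  v_smooth : ContDiff ℝ 3 v
  P_smooth : ContDiff ℝ 3 P
  η_smooth : ContDiff ℝ 4 η
  ψ_smooth : ContDiff ℝ 4 ψ
  γ_smooth : ContDiffOn ℝ 2 γ (Icc 0 m)
  u_periodic : ∀ x y, u (x + 2 * L, y) = u (x, y)
  v_periodic : ∀ x y, v (x + 2 * L, y) = v (x, y)
  P_periodic : ∀ x y, P (x + 2 * L, y) = P (x, y)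
  η_periodic : ∀ x, η (x + 2 * L) = η x
  η_mean : (∫ x in (-L)..L, η x) = 0
  u_even : ∀ x y, u (-x, y) = u (x, y)
  v_odd : ∀ x y, v (-x, y) = -v (x, y)
  P_even : ∀ x y, P (-x, y) = P (x, y)
  η_even : ∀ x, η (-x) = η x
  euler_x : ∀ x y, -d < y → y < η x →
    u (x, y) * pdX u (x, y) + v (x, y) * pdY u (x, y) = -pdX P (x, y)
  euler_y : ∀ x y, -d < y → y < η x →
    u (x, y) * pdX v (x, y) + v (x, y) * pdY v (x, y) = -(pdY P (x, y)) - g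
  incompressible : ∀ x y, -d < y → y < η x → pdX u (x, y) + pdY v (x, y) = 0
  surface_pressure : ∀ x, P (x, η x) = Patm
  surface_kinematic : ∀ x, v (x, η x) = deriv η x * u (x, η x)
  bed_kinematic : ∀ x, v (x, -d) = 0
  nonstagnant : ∃ δ > 0, ∀ x y, -d ≤ y → y ≤ η x → u (x, y) ≤ -δ
  psi_x : ∀ x y, -d ≤ y → y ≤ η x → pdX ψ (x, y) = -v (x, y)
  psi_y : ∀ x y, -d ≤ y → y ≤ η x → pdY ψ (x, y) = u (x, y)
  psi_surface : ∀ x, ψ (x, η x) = 0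
  psi_bed : ∀ x, ψ (x, -d) = m
  vorticity_eq : ∀ x y, -d < y → y < η x → pdX v (x, y) - pdY u (x, y) = γ (ψ (x, y))

namespace PeriodicWave

variable {g Patm L : ℝ}

/-- The closure of one period `Ω` of the fluid domain. -/
def Ωbar (W : PeriodicWave g Patm L) : Set (ℝ × ℝ) :=
  {p | -L ≤ p.1 ∧ p.1 ≤ L ∧ -W.d ≤ p.2 ∧ p.2 ≤ W.η p.1}

/-- The open half period `Ω⁺` of the fluid domain. -/
def Ωplus (W : PeriodicWave g Patm L) : Set (ℝ × ℝ) :=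
  {p | 0 < p.1 ∧ p.1 < L ∧ -W.d < p.2 ∧ p.2 < W.η p.1}

/-- The half period `S⁺` of the free surface. -/
def Splus (W : PeriodicWave g Patm L) : Set (ℝ × ℝ) :=
  {p | 0 < p.1 ∧ p.1 < L ∧ p.2 = W.η p.1}

/-- A wave is trivial if `u, v, P, η` depend only on `y`. -/
def IsTrivial (W : PeriodicWave g Patm L) : Prop :=
  (∀ p, W.v p = 0) ∧ (∀ x, W.η x = 0) ∧
    (∀ x x' y, W.u (x, y) = W.u (x', y)) ∧ (∀ x x' y, W.P (x, y) = W.P (x', y))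

/-- The streamline monotonicity condition `v > 0` on `Ω⁺ ∪ S⁺`. -/
def MonotoneHalf (W : PeriodicWave g Patm L) : Prop :=
  ∀ p ∈ W.Ωplus ∪ W.Splus, 0 < W.v p

/-- Membership in the water-wave set 𝒲 : the vorticity function satisfies
`γ ≤ 0`, `γ' ≤ 0`, `γ'' ≤ 0` on `[0, m]`, and the wave is either trivial or
monotone. -/
def MemW (W : PeriodicWave g Patm L) : Prop :=
  (∀ s ∈ Icc (0:ℝ) W.m, W.γ s ≤ 0) ∧
  (∀ s ∈ Icc (0:ℝ) W.m, derivWithin W.γ (Icc 0 W.m) s ≤ 0) ∧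
  (∀ s ∈ Icc (0:ℝ) W.m, derivWithin (derivWithin W.γ (Icc 0 W.m)) (Icc 0 W.m) s ≤ 0) ∧
  (W.IsTrivial ∨ W.MonotoneHalf)

/-- The trace of `(u, v, u_x, v_x, u_y, u_xx, u_xy)` on the free surface. -/
noncomputable def trace (W : PeriodicWave g Patm L) (x : ℝ) :
    ℝ × ℝ × ℝ × ℝ × ℝ × ℝ × ℝ :=
  (W.u (x, W.η x), W.v (x, W.η x), pdX W.u (x, W.η x), pdX W.v (x, W.η x),
    pdY W.u (x, W.η x), pdX (pdX W.u) (x, W.η x), pdY (pdX W.u) (x, W.η x))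

end PeriodicWave

/-! ### Partial derivatives of functions of two variables -/

theorem ContDiff.pdX {f : ℝ × ℝ → ℝ} {m n : WithTop ℕ∞} (hf : ContDiff ℝ n f) (h : m + 1 ≤ n) :
    ContDiff ℝ m (pdX f) :=
  (hf.fderiv_right h).clm_apply contDiff_const

theorem ContDiff.pdY {f : ℝ × ℝ → ℝ} {m n : WithTop ℕ∞} (hf : ContDiff ℝ n f) (h : m + 1 ≤ n) :
    ContDiff ℝ m (pdY f) :=
  (hf.fderiv_right h).clm_apply contDiff_const

theorem hasDerivAt_comp_curve {f : ℝ × ℝ → ℝ} {a b : ℝ → ℝ} {a' b' t : ℝ}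
    (hf : DifferentiableAt ℝ f (a t, b t)) (ha : HasDerivAt a a' t) (hb : HasDerivAt b b' t) :
    HasDerivAt (fun s => f (a s, b s)) (a' * pdX f (a t, b t) + b' * pdY f (a t, b t)) t := by
  have h := hf.hasFDerivAt.comp_hasDerivAt t (ha.prodMk hb)
  have e : fderiv ℝ f (a t, b t) (a', b') = a' * pdX f (a t, b t) + b' * pdY f (a t, b t) := by
    have : ((a', b') : ℝ × ℝ) = a' • ((1 : ℝ), (0 : ℝ)) + b' • ((0 : ℝ), (1 : ℝ)) := by
      ext <;> simp
    rw [this, map_add, map_smul, map_smul]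
    rfl
  rw [e] at h
  exact h

theorem hasDerivAt_slice_fst {f : ℝ × ℝ → ℝ} {x y : ℝ} (hf : DifferentiableAt ℝ f (x, y)) :
    HasDerivAt (fun s => f (s, y)) (pdX f (x, y)) x := by
  simpa using hasDerivAt_comp_curve (a := fun s => s) (b := fun _ => y) hf (hasDerivAt_id x)
    (hasDerivAt_const x y)

theorem hasDerivAt_slice_snd {f : ℝ × ℝ → ℝ} {x y : ℝ} (hf : DifferentiableAt ℝ f (x, y)) :
    HasDerivAt (fun s => f (x, s)) (pdY f (x, y)) y := by
  simpa using hasDerivAt_comp_curve (a := fun _ => x) (b := fun s => s) hf (hasDerivAt_const y x)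
    (hasDerivAt_id y)

theorem pdX_eq_of_hasDerivAt {f : ℝ × ℝ → ℝ} {x y d : ℝ} (hf : DifferentiableAt ℝ f (x, y))
    (h : HasDerivAt (fun s => f (s, y)) d x) : pdX f (x, y) = d :=
  (hasDerivAt_slice_fst hf).unique h

theorem pdY_eq_of_hasDerivAt {f : ℝ × ℝ → ℝ} {x y d : ℝ} (hf : DifferentiableAt ℝ f (x, y))
    (h : HasDerivAt (fun s => f (x, s)) d y) : pdY f (x, y) = d :=
  (hasDerivAt_slice_snd hf).unique h

theorem pdY_pdX_comm {f : ℝ × ℝ → ℝ} (hf : ContDiff ℝ 2 f) : pdY (pdX f) = pdX (pdY f) := by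
  funext p
  have hd : DifferentiableAt ℝ (fderiv ℝ f) p :=
    ((hf.fderiv_right (m := 1) (by norm_num)).differentiable (by norm_num)) p
  have hs : IsSymmSndFDerivAt ℝ f p := hf.contDiffAt.isSymmSndFDerivAt (by simp)
  have key : ∀ w z : ℝ × ℝ, fderiv ℝ (fun q => fderiv ℝ f q w) p z
      = fderiv ℝ (fderiv ℝ f) p z w := by
    intro w z
    rw [fderiv_clm_apply hd (differentiableAt_const w)]
    simp
  change fderiv ℝ (fun q => fderiv ℝ f q (1, 0)) p (0, 1)
    = fderiv ℝ (fun q => fderiv ℝ f q (0, 1)) p (1, 0)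
  rw [key, key]
  exact hs _ _

theorem pdX_add_const_mul {f b : ℝ × ℝ → ℝ} (hf : Differentiable ℝ f) (hb : Differentiable ℝ b)
    (ε : ℝ) : pdX (fun p => f p + ε * b p) = fun p => pdX f p + ε * pdX b p := by
  funext ⟨x, y⟩
  exact pdX_eq_of_hasDerivAt ((hf.add (hb.const_mul ε)) (x, y))
    ((hasDerivAt_slice_fst (hf _)).add ((hasDerivAt_slice_fst (hb _)).const_mul ε))

theorem pdY_add_const_mul {f b : ℝ × ℝ → ℝ} (hf : Differentiable ℝ f) (hb : Differentiable ℝ b)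
    (ε : ℝ) : pdY (fun p => f p + ε * b p) = fun p => pdY f p + ε * pdY b p := by
  funext ⟨x, y⟩
  exact pdY_eq_of_hasDerivAt ((hf.add (hb.const_mul ε)) (x, y))
    ((hasDerivAt_slice_snd (hf _)).add ((hasDerivAt_slice_snd (hb _)).const_mul ε))

theorem contDiff_one_pdX {f : ℝ × ℝ → ℝ} (hf : ContDiff ℝ 2 f) : ContDiff ℝ 1 (pdX f) :=
  hf.pdX (by norm_num)

theorem contDiff_one_pdY {f : ℝ × ℝ → ℝ} (hf : ContDiff ℝ 2 f) : ContDiff ℝ 1 (pdY f) :=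
  hf.pdY (by norm_num)

/-- The Laplacian in the plane. -/
noncomputable def lap (f : ℝ × ℝ → ℝ) (p : ℝ × ℝ) : ℝ := pdX (pdX f) p + pdY (pdY f) p

theorem lap_add_const_mul {f b : ℝ × ℝ → ℝ} (hf : ContDiff ℝ 2 f) (hb : ContDiff ℝ 2 b)
    (ε : ℝ) (p : ℝ × ℝ) : lap (fun p => f p + ε * b p) p = lap f p + ε * lap b p := by
  have d2 : (2 : WithTop ℕ∞) ≠ 0 := by norm_num
  unfold lap
  rw [pdX_add_const_mul (hf.differentiable d2) (hb.differentiable d2),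
    pdY_add_const_mul (hf.differentiable d2) (hb.differentiable d2),
    pdX_add_const_mul ((contDiff_one_pdX hf).differentiable one_ne_zero)
      ((contDiff_one_pdX hb).differentiable one_ne_zero),
    pdY_add_const_mul ((contDiff_one_pdY hf).differentiable one_ne_zero)
      ((contDiff_one_pdY hb).differentiable one_ne_zero)]
  ring

/-! ### Maximum principles -/

theorem IsLocalMax.second_deriv_nonpos {φ φ' : ℝ → ℝ} {a s : ℝ}
    (h : IsLocalMax φ a) (h1 : ∀ t, HasDerivAt φ (φ' t) t) (h2 : HasDerivAt φ' s a) : s ≤ 0 := by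
  by_contra! hs
  have hφ' : deriv φ = φ' := funext fun t => (h1 t).deriv
  have h0 : φ' a = 0 := h.hasDerivAt_eq_zero (h1 a)
  have hmin : IsLocalMin φ a := by
    apply isLocalMin_of_deriv_deriv_pos
    · rw [hφ', h2.deriv]; exact hs
    · rw [hφ', h0]
    · exact (h1 a).continuousAt
  have hc : ∀ᶠ t in nhds a, φ t = φ a := by
    filter_upwards [h, hmin] with t ht ht' using le_antisymm ht ht'
  have hc' : ∀ᶠ t in nhds a, φ' t = 0 := by
    filter_upwards [hc.eventually_nhds] with t ht
    have : HasDerivAt φ 0 t := (hasDerivAt_const t (φ a)).congr_of_eventuallyEq ht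
    exact (h1 t).unique this
  have : HasDerivAt φ' 0 a := (hasDerivAt_const a (0 : ℝ)).congr_of_eventuallyEq hc'
  linarith [h2.unique this]

theorem IsLocalMax.lap_nonpos {h : ℝ × ℝ → ℝ} {p : ℝ × ℝ} (hm : IsLocalMax h p)
    (hh : ContDiff ℝ 2 h) : lap h p ≤ 0 := by
  obtain ⟨x, y⟩ := p
  have d2 : (2 : WithTop ℕ∞) ≠ 0 := by norm_num
  have hx : IsLocalMax (fun s => h (s, y)) x := by
    have : Filter.Tendsto (fun s : ℝ => (s, y)) (nhds x) (nhds (x, y)) :=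
      Continuous.tendsto (by fun_prop) x
    exact this.eventually hm
  have hy : IsLocalMax (fun s => h (x, s)) y := by
    have : Filter.Tendsto (fun s : ℝ => (x, s)) (nhds y) (nhds (x, y)) :=
      Continuous.tendsto (by fun_prop) y
    exact this.eventually hm
  have h1 := hx.second_deriv_nonpos (fun t => hasDerivAt_slice_fst (hh.differentiable d2 (t, y)))
    (hasDerivAt_slice_fst ((contDiff_one_pdX hh).differentiable one_ne_zero (x, y)))
  have h2 := hy.second_deriv_nonpos (fun t => hasDerivAt_slice_snd (hh.differentiable d2 (x, t)))
    (hasDerivAt_slice_snd ((contDiff_one_pdY hh).differentiable one_ne_zero (x, y)))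
  unfold lap
  linarith

theorem neg_of_lap_pos {K U : Set (ℝ × ℝ)} {h c : ℝ × ℝ → ℝ} (hK : IsCompact K) (hU : IsOpen U)
    (hUK : U ⊆ K) (hh : ContDiff ℝ 2 h) (hc : ∀ p ∈ U, c p ≤ 0)
    (hL : ∀ p ∈ U, 0 < lap h p + c p * h p) (hb : ∀ p ∈ K \ U, h p ≤ 0) :
    ∀ p ∈ U, h p < 0 := by
  by_contra! hcon
  obtain ⟨p, hpU, hp⟩ := hcon
  obtain ⟨q, hqK, hq⟩ := hK.exists_isMaxOn ⟨p, hUK hpU⟩ hh.continuous.continuousOn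
  have hmax : ∃ r ∈ U, 0 ≤ h r ∧ ∀ z ∈ K, h z ≤ h r := by
    by_cases hqU : q ∈ U
    · exact ⟨q, hqU, hp.trans (hq (hUK hpU)), hq⟩
    · exact ⟨p, hpU, hp, fun z hz => (hq hz).trans ((hb q ⟨hqK, hqU⟩).trans hp)⟩
  obtain ⟨r, hrU, hr, hrm⟩ := hmax
  have hloc : IsLocalMax h r :=
    Filter.mem_of_superset (hU.mem_nhds hrU) fun z hz => hrm z (hUK hz)
  have h1 := hloc.lap_nonpos hh
  have h2 := mul_nonpos_of_nonpos_of_nonneg (hc r hrU) hr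
  linarith [hL r hrU]

theorem contDiff_exp_fst (a : ℝ) : ContDiff ℝ 2 (fun p : ℝ × ℝ => Real.exp (a * p.1)) := by
  fun_prop

theorem lap_exp_fst (a : ℝ) (p : ℝ × ℝ) :
    lap (fun p : ℝ × ℝ => Real.exp (a * p.1)) p = a ^ 2 * Real.exp (a * p.1) := by
  obtain ⟨x, y⟩ := p
  have e1 : ∀ x, HasDerivAt (fun s => Real.exp (a * s)) (a * Real.exp (a * x)) x := fun x => by
    simpa [mul_comm] using ((hasDerivAt_id x).const_mul a).exp
  have h1 : pdX (fun p : ℝ × ℝ => Real.exp (a * p.1)) = fun p => a * Real.exp (a * p.1) := by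
    funext ⟨x, y⟩
    exact pdX_eq_of_hasDerivAt (by fun_prop) (e1 x)
  have h2 : pdY (fun p : ℝ × ℝ => Real.exp (a * p.1)) = fun p => 0 := by
    funext ⟨x, y⟩
    exact pdY_eq_of_hasDerivAt (by fun_prop) (hasDerivAt_const y (Real.exp (a * x)))
  unfold lap
  rw [h1, h2, pdX_eq_of_hasDerivAt (d := a * (a * Real.exp (a * x))) (by fun_prop)
    ((e1 x).const_mul a), pdY_eq_of_hasDerivAt (d := 0) (by fun_prop) (hasDerivAt_const _ _)]
  ring

theorem neg_of_neg_boundary {K U : Set (ℝ × ℝ)} {f c : ℝ × ℝ → ℝ} {M : ℝ} (hK : IsCompact K)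
    (hU : IsOpen U) (hUK : U ⊆ K) (hf : ContDiff ℝ 2 f) (hc : ∀ p ∈ U, c p ≤ 0)
    (hcM : ∀ p ∈ U, -M ≤ c p) (hL : ∀ p ∈ U, 0 ≤ lap f p + c p * f p)
    (hb : ∀ p ∈ K \ U, f p < 0) : ∀ p ∈ U, f p < 0 := by
  set a : ℝ := |M| + 1 with ha
  have ha2 : M < a ^ 2 := by nlinarith [le_abs_self M, abs_nonneg M]
  have hKU : IsCompact (K \ U) := hK.diff hU
  obtain ⟨ε, hε, hεb⟩ : ∃ ε > 0, ∀ p ∈ K \ U, f p + ε * Real.exp (a * p.1) ≤ 0 := by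
    rcases (K \ U).eq_empty_or_nonempty with h0 | hne
    · exact ⟨1, one_pos, by simp [h0]⟩
    · obtain ⟨q, hq, hqm⟩ := hKU.exists_isMinOn (f := fun p => -f p / Real.exp (a * p.1)) hne
        (by
          apply Continuous.continuousOn
          have := hf.continuous
          exact (this.neg).div (by fun_prop) fun p => (Real.exp_pos _).ne')
      refine ⟨-f q / Real.exp (a * q.1), div_pos (by linarith [hb q hq]) (Real.exp_pos _), ?_⟩
      intro p hp
      have : -f q / Real.exp (a * q.1) ≤ -f p / Real.exp (a * p.1) := hqm hp
      rw [le_div_iff₀ (Real.exp_pos _)] at this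
      linarith
  have := neg_of_lap_pos (h := fun p => f p + ε * Real.exp (a * p.1)) hK hU hUK
    (hf.add (contDiff_const.mul (contDiff_exp_fst a))) hc (fun p hp => by
      rw [lap_add_const_mul hf (contDiff_exp_fst a), lap_exp_fst]
      have h1 : 0 < ε * Real.exp (a * p.1) * (a ^ 2 + c p) :=
        mul_pos (mul_pos hε (Real.exp_pos _)) (by linarith [hcM p hp])
      linarith [hL p hp]) hεb
  intro p hp
  have h1 := this p hp
  have h2 := mul_pos hε (Real.exp_pos (a * p.1))
  linarith

theorem nonpos_of_nonpos_boundary {K U : Set (ℝ × ℝ)} {f c : ℝ × ℝ → ℝ} {M : ℝ}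
    (hK : IsCompact K) (hU : IsOpen U) (hUK : U ⊆ K) (hf : ContDiff ℝ 2 f)
    (hc : ∀ p ∈ U, c p ≤ 0) (hcM : ∀ p ∈ U, -M ≤ c p)
    (hL : ∀ p ∈ U, 0 ≤ lap f p + c p * f p) (hb : ∀ p ∈ K \ U, f p ≤ 0) :
    ∀ p ∈ U, f p ≤ 0 := by
  intro p hp
  apply le_of_forall_pos_lt_add
  intro ε hε
  have e : ∀ q, lap (fun q => f q + ε * (fun _ => (-1 : ℝ)) q) q = lap f q := by
    intro q
    rw [lap_add_const_mul hf contDiff_const]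
    have hX : pdX (fun _ => (-1 : ℝ)) = fun _ => 0 := by funext p; simp [pdX]
    have hY : pdY (fun _ => (-1 : ℝ)) = fun _ => 0 := by funext p; simp [pdY]
    simp [lap, hX, hY, pdX, pdY]
  have := neg_of_neg_boundary (f := fun q => f q + ε * (fun _ => (-1 : ℝ)) q) hK hU hUK
    (hf.add (contDiff_const.mul contDiff_const)) hc hcM (fun q hq => by
      rw [e]
      have := mul_nonneg hε.le (neg_nonneg.2 (hc q hq))
      linarith [hL q hq]) (fun q hq => by
      have := hb q hq
      simp only
      linarith) p hp
  simp only at this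
  linarith

/-- The squared Euclidean distance of a point of the plane from `(x₀, y₀)`. -/
def sqDist (x₀ y₀ : ℝ) (p : ℝ × ℝ) : ℝ := (p.1 - x₀) ^ 2 + (p.2 - y₀) ^ 2

theorem continuous_sqDist (x₀ y₀ : ℝ) : Continuous (sqDist x₀ y₀) := by
  unfold sqDist; fun_prop

theorem contDiff_gaussian (x₀ y₀ a α β : ℝ) :
    ContDiff ℝ 2 (fun p : ℝ × ℝ => (α + β * p.1) * Real.exp (-a * sqDist x₀ y₀ p)) := by
  unfold sqDist; fun_prop

theorem lap_gaussian (x₀ y₀ a α β : ℝ) (p : ℝ × ℝ) :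
    lap (fun p : ℝ × ℝ => (α + β * p.1) * Real.exp (-a * sqDist x₀ y₀ p)) p =
      ((α + β * p.1) * (4 * a ^ 2 * sqDist x₀ y₀ p - 4 * a) - 4 * a * β * (p.1 - x₀)) *
        Real.exp (-a * sqDist x₀ y₀ p) := by
  obtain ⟨x, y⟩ := p
  have ex : ∀ x y, HasDerivAt (fun s => Real.exp (-a * sqDist x₀ y₀ (s, y)))
      (-2 * a * (x - x₀) * Real.exp (-a * sqDist x₀ y₀ (x, y))) x := fun x y => by
    have h := ((((hasDerivAt_id' x).sub_const x₀).fun_pow 2).add_const ((y - y₀) ^ 2)).const_mul (-a)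
    have h2 := h.exp
    simp only [sqDist]
    convert h2 using 1
    simp
    ring
  have ey : ∀ x y, HasDerivAt (fun s => Real.exp (-a * sqDist x₀ y₀ (x, s)))
      (-2 * a * (y - y₀) * Real.exp (-a * sqDist x₀ y₀ (x, y))) y := fun x y => by
    have h := ((((hasDerivAt_id' y).sub_const y₀).fun_pow 2).const_add ((x - x₀) ^ 2)).const_mul (-a)
    have h2 := h.exp
    simp only [sqDist]
    convert h2 using 1
    simp
    ring
  have el : ∀ x, HasDerivAt (fun s => α + β * s) β x := fun x => by
    simpa using ((hasDerivAt_id x).const_mul β).const_add α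
  have es : ∀ x x₀, HasDerivAt (fun s => -2 * a * (s - x₀)) (-2 * a) x := fun x x₀ => by
    simpa using (((hasDerivAt_id x).sub_const x₀).const_mul (-2 * a))
  have h1 : pdX (fun p : ℝ × ℝ => (α + β * p.1) * Real.exp (-a * sqDist x₀ y₀ p)) = fun p =>
      β * Real.exp (-a * sqDist x₀ y₀ p) +
        (α + β * p.1) * (-2 * a * (p.1 - x₀) * Real.exp (-a * sqDist x₀ y₀ p)) := by
    funext ⟨x, y⟩
    exact pdX_eq_of_hasDerivAt (by unfold sqDist; fun_prop) ((el x).mul (ex x y))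
  have h2 : pdY (fun p : ℝ × ℝ => (α + β * p.1) * Real.exp (-a * sqDist x₀ y₀ p)) = fun p =>
        (α + β * p.1) * (-2 * a * (p.2 - y₀) * Real.exp (-a * sqDist x₀ y₀ p)) := by
    funext ⟨x, y⟩
    exact pdY_eq_of_hasDerivAt (by unfold sqDist; fun_prop) ((ey x y).const_mul (α + β * x))
  unfold lap
  rw [h1, h2, pdX_eq_of_hasDerivAt (by unfold sqDist; fun_prop)
    (((ex x y).const_mul β).add ((el x).fun_mul ((es x x₀).fun_mul (ex x y)))),
    pdY_eq_of_hasDerivAt (by unfold sqDist; fun_prop)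
    (((es y y₀).fun_mul (ey x y)).const_mul (α + β * x))]
  simp only [sqDist]
  ring

theorem isCompact_sqDist_le (x₀ y₀ s : ℝ) : IsCompact {p | sqDist x₀ y₀ p ≤ s} := by
  apply Metric.isCompact_of_isClosed_isBounded
  · exact isClosed_le (continuous_sqDist x₀ y₀) continuous_const
  · apply (Metric.isBounded_closedBall (x := (x₀, y₀)) (r := 1 + |s|)).subset
    rintro ⟨x, y⟩ h
    simp only [sqDist, mem_ofPred_eq] at h
    have h1 : s ≤ (1 + |s|) ^ 2 := by nlinarith [le_abs_self s, abs_nonneg s]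
    rw [Metric.mem_closedBall, Prod.dist_eq, Real.dist_eq, Real.dist_eq]
    exact max_le (abs_le_of_sq_le_sq (by nlinarith [sq_nonneg (y - y₀)]) (by positivity))
      (abs_le_of_sq_le_sq (by nlinarith [sq_nonneg (x - x₀)]) (by positivity))

/-- A barrier estimate in the part of an annulus where the affine function `α + β x` is
positive; it contains the barriers behind both Hopf's and Serrin's boundary point lemmas. -/
theorem annulus_barrier {f c : ℝ × ℝ → ℝ} {x₀ y₀ r R M δ α β : ℝ} (hr : 0 < r)
    (hδ : 0 < δ) (hf : ContDiff ℝ 2 f)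
    (hβ : ∀ x, β * (x - x₀) ≤ α + β * x)
    (hA : ∀ p, r ^ 2 < sqDist x₀ y₀ p → sqDist x₀ y₀ p < R ^ 2 → 0 < α + β * p.1 →
      c p ≤ 0 ∧ -M ≤ c p ∧ 0 ≤ lap f p + c p * f p)
    (hK : ∀ p, r ^ 2 ≤ sqDist x₀ y₀ p → sqDist x₀ y₀ p ≤ R ^ 2 → 0 ≤ α + β * p.1 → f p ≤ 0)
    (hi : ∀ p, sqDist x₀ y₀ p = r ^ 2 → 0 ≤ α + β * p.1 → f p ≤ -δ * (α + β * p.1)) :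
    ∃ ε > 0, ∃ a > 0, ∀ p, r ^ 2 ≤ sqDist x₀ y₀ p → sqDist x₀ y₀ p ≤ R ^ 2 → 0 ≤ α + β * p.1 →
      f p ≤ -ε * (α + β * p.1) * (Real.exp (-a * sqDist x₀ y₀ p) - Real.exp (-a * R ^ 2)) := by
  set a : ℝ := 3 / r ^ 2 + |M| + 1 with ha
  have hr2 : 0 < r ^ 2 := by positivity
  have ha0 : 0 < a := by positivity
  have har : 3 ≤ a * r ^ 2 := by
    have : a * r ^ 2 = 3 + (|M| + 1) * r ^ 2 := by rw [ha]; field_simp; ring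
    have : 0 ≤ (|M| + 1) * r ^ 2 := by positivity
    linarith
  have haM : M < 4 * a := by
    have : 0 < 3 / r ^ 2 := by positivity
    linarith [le_abs_self M, abs_nonneg M]
  refine ⟨δ, hδ, a, ha0, ?_⟩
  set eR : ℝ := Real.exp (-a * R ^ 2) with heR
  have heR0 : 0 < eR := Real.exp_pos _
  set g₁ : ℝ × ℝ → ℝ := fun p => (α + β * p.1) * Real.exp (-a * sqDist x₀ y₀ p) with hg₁
  set g₂ : ℝ × ℝ → ℝ := fun p => (α + β * p.1) * Real.exp (-0 * sqDist x₀ y₀ p) with hg₂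
  have cg₁ : ContDiff ℝ 2 g₁ := contDiff_gaussian x₀ y₀ a α β
  have cg₂ : ContDiff ℝ 2 g₂ := contDiff_gaussian x₀ y₀ 0 α β
  have vg₂ : ∀ p, g₂ p = α + β * p.1 := fun p => by simp [hg₂]
  have lg₂ : ∀ p, lap g₂ p = 0 := fun p => by rw [hg₂, lap_gaussian]; simp
  set U : Set (ℝ × ℝ) := {p | r ^ 2 < sqDist x₀ y₀ p ∧ sqDist x₀ y₀ p < R ^ 2 ∧ 0 < α + β * p.1}
    with hU
  set K : Set (ℝ × ℝ) := {p | sqDist x₀ y₀ p ≤ R ^ 2} ∩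
    {p | r ^ 2 ≤ sqDist x₀ y₀ p ∧ 0 ≤ α + β * p.1} with hKdef
  have hcs := continuous_sqDist x₀ y₀
  have hl : Continuous fun p : ℝ × ℝ => α + β * p.1 := by fun_prop
  have hUo : IsOpen U := by
    apply (isOpen_lt continuous_const hcs).inter
    exact (isOpen_lt hcs continuous_const).inter (isOpen_lt continuous_const hl)
  have hKc : IsCompact K := by
    apply (isCompact_sqDist_le x₀ y₀ (R ^ 2)).inter_right
    exact (isClosed_le continuous_const hcs).inter (isClosed_le continuous_const hl)
  have hUK : U ⊆ K := fun p hp => ⟨hp.2.1.le, hp.1.le, hp.2.2.le⟩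
  have hbd : ∀ p ∈ K \ U, (f p + δ * g₁ p) + (-(δ * eR)) * g₂ p ≤ 0 := by
    rintro p ⟨⟨h2, h1, h3⟩, hn⟩
    rw [vg₂]
    have h2' : sqDist x₀ y₀ p ≤ R ^ 2 := h2
    have e : f p + δ * g₁ p + -(δ * eR) * (α + β * p.1)
        = f p + δ * (α + β * p.1) * (Real.exp (-a * sqDist x₀ y₀ p) - eR) := by
      simp only [hg₁]; ring
    rw [e]
    rcases h1.eq_or_lt with h1 | h1
    · have := hi p h1.symm h3
      have hle : Real.exp (-a * sqDist x₀ y₀ p) - eR ≤ 1 := by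
        have : Real.exp (-a * sqDist x₀ y₀ p) ≤ 1 := Real.exp_le_one_iff.2 (by nlinarith)
        linarith
      nlinarith [mul_le_mul_of_nonneg_left hle (mul_nonneg hδ.le h3)]
    · rcases h2'.eq_or_lt with h2 | h2
      · rw [h2]; simp only [heR, sub_self, mul_zero, add_zero]
        exact hK p h1.le h2.le h3
      · rcases h3.eq_or_lt with h3 | h3
        · rw [← h3]; simp only [mul_zero, zero_mul, add_zero]
          exact hK p h1.le h2.le h3.le
        · exact absurd ⟨h1, h2, h3⟩ hn
  have hin := neg_of_lap_pos (h := fun p => (f p + δ * g₁ p) + (-(δ * eR)) * g₂ p) (c := c)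
    hKc hUo hUK ((hf.add (contDiff_const.mul cg₁)).add (contDiff_const.mul cg₂))
    (fun p hp => (hA p hp.1 hp.2.1 hp.2.2).1) (by
      rintro p ⟨h1, h2, h3⟩
      obtain ⟨c0, cM, hL⟩ := hA p h1 h2 h3
      rw [lap_add_const_mul (hf.add (contDiff_const.mul cg₁)) cg₂,
        lap_add_const_mul hf cg₁, lg₂, vg₂, hg₁, lap_gaussian]
      simp only
      set N := sqDist x₀ y₀ p
      set l := α + β * p.1
      set e := Real.exp (-a * N)
      have he : 0 < e := Real.exp_pos _
      have k1 : 4 * a * β * (p.1 - x₀) ≤ 4 * a * l := by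
        have := mul_le_mul_of_nonneg_left (hβ p.1) (by positivity : 0 ≤ 4 * a)
        linarith
      have k2 : 0 ≤ -c p * eR := mul_nonneg (by linarith) heR0.le
      have k3 : 0 < 4 * a ^ 2 * N - 8 * a + c p := by
        have : a * 3 ≤ a * (a * N) := by
          apply mul_le_mul_of_nonneg_left _ ha0.le
          exact har.trans (mul_le_mul_of_nonneg_left h1.le ha0.le)
        nlinarith
      have k4 : 0 < δ * (l * e * (4 * a ^ 2 * N - 8 * a + c p)) :=
        mul_pos hδ (mul_pos (mul_pos h3 he) k3)
      have k5 : 0 ≤ δ * (e * (4 * a * l - 4 * a * β * (p.1 - x₀))) :=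
        mul_nonneg hδ.le (mul_nonneg he.le (by linarith))
      have k6 : 0 ≤ δ * l * (-c p * eR) := mul_nonneg (mul_nonneg hδ.le h3.le) k2
      linarith) hbd
  intro p h1 h2 h3
  have hp : (f p + δ * g₁ p) + (-(δ * eR)) * g₂ p ≤ 0 := by
    by_cases hpU : p ∈ U
    · exact (hin p hpU).le
    · exact hbd p ⟨⟨h2, h1, h3⟩, hpU⟩
  rw [vg₂] at hp
  simp only [hg₁] at hp
  linarith

theorem HasDerivAt.nonneg_of_le_left {k : ℝ → ℝ} {k' a b : ℝ} (h : HasDerivAt k k' b)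
    (hab : a < b) (hk : ∀ t, a ≤ t → t < b → k t ≤ k b) : 0 ≤ k' := by
  have ht := (hasDerivAt_iff_tendsto_slope.1 h).mono_left
    (nhdsWithin_mono b (show Iio b ⊆ {b}ᶜ from fun t ht => ne_of_lt ht))
  refine ge_of_tendsto ht ?_
  filter_upwards [Ico_mem_nhdsLT hab] with t ht
  rw [slope_def_field]
  exact div_nonneg_of_nonpos (by linarith [hk t ht.1 ht.2]) (by linarith [ht.2])

theorem HasDerivAt.nonpos_of_le_right {k : ℝ → ℝ} {k' a b : ℝ} (h : HasDerivAt k k' a)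
    (hab : a < b) (hk : ∀ t, a < t → t ≤ b → k t ≤ k a) : k' ≤ 0 := by
  have ht := (hasDerivAt_iff_tendsto_slope.1 h).mono_left
    (nhdsWithin_mono a (show Ioi a ⊆ {a}ᶜ from fun t ht => ne_of_gt ht))
  refine le_of_tendsto ht ?_
  filter_upwards [Ioc_mem_nhdsGT hab] with t ht
  rw [slope_def_field]
  exact div_nonpos_of_nonpos_of_nonneg (by linarith [hk t ht.1 ht.2]) (by linarith [ht.1])

theorem sqDist_le_subset_closedBall {x₀ y₀ r : ℝ} (hr : 0 ≤ r) {p : ℝ × ℝ}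
    (h : sqDist x₀ y₀ p ≤ r ^ 2) : p ∈ Metric.closedBall (x₀, y₀) r := by
  unfold sqDist at h
  rw [Metric.mem_closedBall, Prod.dist_eq, Real.dist_eq, Real.dist_eq]
  exact max_le (abs_le_of_sq_le_sq (by nlinarith [sq_nonneg (p.2 - y₀)]) hr)
    (abs_le_of_sq_le_sq (by nlinarith [sq_nonneg (p.1 - x₀)]) hr)

theorem disc_barrier {f c : ℝ × ℝ → ℝ} {x₀ y₀ r R M : ℝ} (hr : 0 < r) (hf : ContDiff ℝ 2 f)
    (hA : ∀ p, sqDist x₀ y₀ p < R ^ 2 → c p ≤ 0 ∧ -M ≤ c p ∧ 0 ≤ lap f p + c p * f p)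
    (hK : ∀ p, sqDist x₀ y₀ p ≤ R ^ 2 → f p ≤ 0)
    (hi : ∀ p, sqDist x₀ y₀ p ≤ r ^ 2 → f p < 0) :
    ∃ ε > 0, ∃ a > 0, ∀ p, r ^ 2 ≤ sqDist x₀ y₀ p → sqDist x₀ y₀ p ≤ R ^ 2 →
      f p ≤ -ε * (Real.exp (-a * sqDist x₀ y₀ p) - Real.exp (-a * R ^ 2)) := by
  obtain ⟨q, hq, hqm⟩ := (isCompact_sqDist_le x₀ y₀ (r ^ 2)).exists_isMaxOn
    ⟨(x₀, y₀), by simp [sqDist]; positivity⟩ hf.continuous.continuousOn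
  obtain ⟨ε, hε, a, ha, h⟩ := annulus_barrier (α := 1) (β := 0) (x₀ := x₀) (y₀ := y₀) (R := R)
    (δ := -f q) hr (by linarith [hi q hq]) hf
    (by simp) (fun p _ h _ => hA p h) (fun p _ h _ => hK p h)
    (fun p h _ => by
      have : f p ≤ f q := hqm (show sqDist x₀ y₀ p ≤ r ^ 2 from h.le)
      linarith)
  refine ⟨ε, hε, a, ha, fun p h1 h2 => ?_⟩
  simpa using h p h1 h2 (by simp)

theorem neg_on_disc {f c : ℝ × ℝ → ℝ} {x₀ y₀ r R M : ℝ} (hr : 0 < r) (hf : ContDiff ℝ 2 f)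
    (hA : ∀ p, sqDist x₀ y₀ p < R ^ 2 → c p ≤ 0 ∧ -M ≤ c p ∧ 0 ≤ lap f p + c p * f p)
    (hK : ∀ p, sqDist x₀ y₀ p ≤ R ^ 2 → f p ≤ 0)
    (hi : ∀ p, sqDist x₀ y₀ p ≤ r ^ 2 → f p < 0) :
    ∀ p, sqDist x₀ y₀ p < R ^ 2 → f p < 0 := by
  intro p hp
  obtain ⟨ε, hε, a, ha, h⟩ := disc_barrier hr hf hA hK hi
  rcases le_total (sqDist x₀ y₀ p) (r ^ 2) with h1 | h1
  · exact hi p h1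
  · have : Real.exp (-a * R ^ 2) < Real.exp (-a * sqDist x₀ y₀ p) :=
      Real.exp_lt_exp.2 (by nlinarith)
    nlinarith [h p h1 hp.le]

theorem strong_maximum_principle {U : Set (ℝ × ℝ)} {f c : ℝ × ℝ → ℝ} {M : ℝ} (hU : IsOpen U)
    (hUc : IsPreconnected U) (hf : ContDiff ℝ 2 f) (hc : ∀ p ∈ U, c p ≤ 0)
    (hcM : ∀ p ∈ U, -M ≤ c p) (hL : ∀ p ∈ U, 0 ≤ lap f p + c p * f p)
    (hf0 : ∀ p ∈ U, f p ≤ 0) (hne : ∃ p ∈ U, f p < 0) : ∀ p ∈ U, f p < 0 := by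
  have hV : IsOpen {p | f p < 0} := isOpen_lt hf.continuous continuous_const
  refine hUc.subset_of_closure_inter_subset hV hne ?_
  rintro p ⟨hpc, hpU⟩
  obtain ⟨ρ, hρ, hball⟩ := Metric.isOpen_iff.1 hU p hpU
  obtain ⟨z, hzV, hzp⟩ := Metric.mem_closure_iff.1 hpc (ρ / 4) (by positivity)
  obtain ⟨s, hs, hsV⟩ := Metric.isOpen_iff.1 hV z hzV
  have hsub : ∀ q, sqDist z.1 z.2 q ≤ (ρ / 2) ^ 2 → q ∈ U := fun q hq => by
    have h1 := Metric.mem_closedBall.1 (sqDist_le_subset_closedBall (by positivity) hq)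
    apply hball
    rw [Metric.mem_ball]
    have := dist_triangle q z p
    rw [dist_comm] at hzp
    linarith [show dist q z ≤ ρ / 2 from h1]
  refine neg_on_disc (x₀ := z.1) (y₀ := z.2) (r := s / 2) (R := ρ / 2) (M := M) (c := c)
    (by positivity) hf (fun q hq => ⟨hc q (hsub q hq.le), hcM q (hsub q hq.le), hL q (hsub q hq.le)⟩)
    (fun q hq => hf0 q (hsub q hq)) (fun q hq => hsV ?_) p ?_
  · have h1 := Metric.mem_closedBall.1 (sqDist_le_subset_closedBall (by positivity) hq)
    rw [Metric.mem_ball]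
    linarith [show dist q z ≤ s / 2 from h1]
  · rw [Prod.dist_eq, Real.dist_eq, Real.dist_eq] at hzp
    have h1 := sq_lt_sq' (by linarith [neg_abs_le (p.1 - z.1), (le_max_left _ _).trans_lt hzp])
      ((le_abs_self _).trans_lt ((le_max_left _ _).trans_lt hzp))
    have h2 := sq_lt_sq' (by linarith [neg_abs_le (p.2 - z.2), (le_max_right _ _).trans_lt hzp])
      ((le_abs_self _).trans_lt ((le_max_right _ _).trans_lt hzp))
    unfold sqDist
    nlinarith

/-- Hopf's boundary point lemma for a disc. -/
theorem hopf_lemma {f c : ℝ × ℝ → ℝ} {x₀ y₀ R M : ℝ} {q : ℝ × ℝ} (hR : 0 < R)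
    (hf : ContDiff ℝ 2 f)
    (hA : ∀ p, sqDist x₀ y₀ p < R ^ 2 →
      f p < 0 ∧ c p ≤ 0 ∧ -M ≤ c p ∧ 0 ≤ lap f p + c p * f p)
    (hK : ∀ p, sqDist x₀ y₀ p = R ^ 2 → f p ≤ 0) (hq : sqDist x₀ y₀ q = R ^ 2) (hfq : f q = 0) :
    0 < (q.1 - x₀) * pdX f q + (q.2 - y₀) * pdY f q := by
  obtain ⟨q₁, q₂⟩ := q
  obtain ⟨ε, hε, a, ha, h⟩ := disc_barrier (r := R / 2) (by positivity) hf
    (fun p hp => (hA p hp).2)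
    (fun p hp => hp.lt_or_eq.elim (fun h => (hA p h).1.le) (hK p))
    (fun p hp => (hA p (hp.trans_lt (by nlinarith))).1)
  have e1 : HasDerivAt (fun t : ℝ => x₀ + t * (q₁ - x₀)) (q₁ - x₀) 1 := by
    simpa using ((hasDerivAt_id (1 : ℝ)).mul_const (q₁ - x₀)).const_add x₀
  have e2 : HasDerivAt (fun t : ℝ => y₀ + t * (q₂ - y₀)) (q₂ - y₀) 1 := by
    simpa using ((hasDerivAt_id (1 : ℝ)).mul_const (q₂ - y₀)).const_add y₀
  have hφ := hasDerivAt_comp_curve (hf.differentiable (by norm_num) _) e1 e2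
  have hexp : HasDerivAt (fun t : ℝ => Real.exp (-a * (t ^ 2 * R ^ 2)))
      (Real.exp (-a * (1 ^ 2 * R ^ 2)) * (-a * (2 * R ^ 2))) 1 := by
    have := ((((hasDerivAt_id' (1 : ℝ)).fun_pow 2).mul_const (R ^ 2)).const_mul (-a)).exp
    simpa using this
  have hk := hφ.add ((hexp.sub_const (Real.exp (-a * R ^ 2))).const_mul ε)
  have key := hk.nonneg_of_le_left (a := 1 / 2) (by norm_num) (by
    intro t h1 h2
    have h3 : 1 / 4 ≤ t ^ 2 := by nlinarith
    have h4 : t ^ 2 ≤ 1 := by nlinarith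
    have hN : sqDist x₀ y₀ (x₀ + t * (q₁ - x₀), y₀ + t * (q₂ - y₀)) = t ^ 2 * R ^ 2 := by
      rw [← hq]; simp only [sqDist]; ring
    have := h (x₀ + t * (q₁ - x₀), y₀ + t * (q₂ - y₀)) (by rw [hN]; nlinarith [sq_nonneg R])
      (by rw [hN]; nlinarith [sq_nonneg R])
    rw [hN] at this
    simp only [Pi.add_apply, one_pow, one_mul, add_sub_cancel, hfq]
    linarith)
  simp only [one_mul, add_sub_cancel, one_pow] at key
  have : 0 < ε * (Real.exp (-a * R ^ 2) * (a * (2 * R ^ 2))) := by positivity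
  simp only
  linarith

/-- Serrin's boundary point lemma at the top of a half disc `{x > 0}`, for a function that
vanishes on the vertical axis. -/
theorem serrin_corner {f c : ℝ × ℝ → ℝ} {Y R M : ℝ} (hR : 0 < R) (hf : ContDiff ℝ 2 f)
    (hA : ∀ p, sqDist 0 (Y - R) p < R ^ 2 → 0 < p.1 →
      f p < 0 ∧ c p ≤ 0 ∧ -M ≤ c p ∧ 0 ≤ lap f p + c p * f p)
    (hK : ∀ p, sqDist 0 (Y - R) p = R ^ 2 → 0 < p.1 → f p ≤ 0)
    (h0 : ∀ y, f (0, y) = 0) (hx : ∀ y, (y - (Y - R)) ^ 2 < R ^ 2 → pdX f (0, y) < 0)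
    (hY : pdX f (0, Y) = 0) : 0 < pdY (pdX f) (0, Y) := by
  have hfx : ContDiff ℝ 1 (pdX f) := contDiff_one_pdX hf
  set q : ℝ × ℝ → ℝ := fun p => ∫ t in (0 : ℝ)..1, pdX f (t * p.1, p.2) with hqdef
  have hqc : Continuous q := by
    apply intervalIntegral.continuous_parametric_intervalIntegral_of_continuous'
    have := hfx.continuous
    simp only [Function.uncurry_def]
    fun_prop
  have hfq : ∀ p : ℝ × ℝ, f p = p.1 * q p := by
    rintro ⟨x, y⟩
    have hd : ∀ t ∈ uIcc (0 : ℝ) 1, HasDerivAt (fun t => f (t * x, y)) (x * pdX f (t * x, y)) t := by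
      intro t _
      simpa using hasDerivAt_comp_curve (a := fun t => t * x) (b := fun _ => y)
        (hf.differentiable (by norm_num) _)
        (by simpa using (hasDerivAt_id t).mul_const x) (hasDerivAt_const t y)
    have := intervalIntegral.integral_eq_sub_of_hasDerivAt hd (by
      apply Continuous.intervalIntegrable
      have := hfx.continuous
      fun_prop)
    rw [intervalIntegral.integral_const_mul] at this
    simp only [one_mul, zero_mul, h0, sub_zero] at this
    exact this.symm
  have hRR : (R / 2) ^ 2 < R ^ 2 := by nlinarith
  have hC : IsCompact ({p | sqDist 0 (Y - R) p ≤ (R / 2) ^ 2} ∩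
      {p : ℝ × ℝ | sqDist 0 (Y - R) p = (R / 2) ^ 2 ∧ 0 ≤ p.1}) := by
    apply (isCompact_sqDist_le _ _ _).inter_right
    exact (isClosed_eq (continuous_sqDist _ _) continuous_const).inter
      (isClosed_le continuous_const continuous_fst)
  obtain ⟨z, ⟨-, hz, hz0⟩, hzm⟩ := hC.exists_isMaxOn
    ⟨(R / 2, Y - R), by simp [sqDist], by simp [sqDist], by positivity⟩ hqc.continuousOn
  have hqz : q z < 0 := by
    rcases hz0.eq_or_lt with h | h
    · have : q z = pdX f (0, z.2) := by simp [hqdef, ← h]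
      rw [this]
      apply hx
      have : sqDist 0 (Y - R) z = (z.2 - (Y - R)) ^ 2 := by simp [sqDist, ← h]
      rw [← this, hz]; exact hRR
    · have h1 := (hA z (by rw [hz]; exact hRR) h).1
      rw [hfq] at h1
      exact (pos_iff_neg_of_mul_neg h1).1 h
  obtain ⟨ε, hε, a, ha, hb⟩ := annulus_barrier (α := 0) (β := 1) (x₀ := 0) (y₀ := Y - R)
    (r := R / 2) (R := R) (M := M) (c := c) (δ := -q z) (by positivity) (by linarith) hf
    (by simp) (fun p _ h h' => (hA p h (by simpa using h')).2)
    (fun p _ h h' => by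
      have h' : 0 ≤ p.1 := by simpa using h'
      rcases h'.eq_or_lt with h' | h'
      · rw [hfq, ← h', zero_mul]
      · exact h.lt_or_eq.elim (fun h => (hA p h h').1.le) (fun h => hK p h h'))
    (fun p h h' => by
      have h' : 0 ≤ p.1 := by simpa using h'
      have : q p ≤ q z := hzm ⟨h.le, h, h'⟩
      rw [hfq]
      nlinarith)
  have hedge : ∀ y, Y - R / 2 ≤ y → y < Y → pdX f (0, y)
      + ε * (Real.exp (-a * (y - (Y - R)) ^ 2) - Real.exp (-a * R ^ 2)) ≤ 0 := by
    intro y h1 h2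
    have hE : Differentiable ℝ fun s : ℝ =>
        Real.exp (-a * sqDist 0 (Y - R) (s, y)) - Real.exp (-a * R ^ 2) := by
      unfold sqDist; fun_prop
    have hd := (hasDerivAt_slice_fst (hf.differentiable (by norm_num) (0, y))).fun_add
      (((hasDerivAt_id' (0 : ℝ)).fun_mul (hE 0).hasDerivAt).const_mul ε)
    have hlt : (y - (Y - R)) ^ 2 < R ^ 2 := by nlinarith
    have := hd.nonpos_of_le_right (b := Real.sqrt (R ^ 2 - (y - (Y - R)) ^ 2))
      (Real.sqrt_pos.2 (by linarith)) (by
        intro t h3 h4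
        have h5 : t ^ 2 ≤ R ^ 2 - (y - (Y - R)) ^ 2 := by
          rw [← Real.sq_sqrt (show 0 ≤ R ^ 2 - (y - (Y - R)) ^ 2 by linarith)]
          exact pow_le_pow_left₀ h3.le h4 2
        have := hb (t, y) (by simp only [sqDist]; nlinarith) (by simp only [sqDist]; linarith)
          (by simpa using h3.le)
        simp only [zero_add, one_mul] at this
        simp only [h0, zero_mul, mul_zero, add_zero]
        linarith)
    simpa [sqDist] using this
  have e1 : HasDerivAt (fun s : ℝ => Real.exp (-a * (s - (Y - R)) ^ 2))
      (Real.exp (-a * (Y - (Y - R)) ^ 2) * (-a * (2 * (Y - (Y - R))))) Y := by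
    simpa using ((((hasDerivAt_id' Y).sub_const (Y - R)).fun_pow 2).const_mul (-a)).exp
  have hk := (hasDerivAt_slice_snd (hfx.differentiable one_ne_zero (0, Y))).fun_add
    ((e1.sub_const (Real.exp (-a * R ^ 2))).const_mul ε)
  have key := hk.nonneg_of_le_left (a := Y - R / 2) (by linarith) (by
    intro t h1 h2
    simpa [hY] using hedge t h1 h2)
  simp only [sub_sub_cancel] at key
  have : 0 < ε * (Real.exp (-a * R ^ 2) * (a * (2 * R))) := by positivity
  linarith

/-! ### The governing equations of a wave -/

namespace PeriodicWave

variable {g Patm L : ℝ}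

/-- The fluid domain, over all periods. -/
def fluid (W : PeriodicWave g Patm L) : Set (ℝ × ℝ) := {p | -W.d < p.2 ∧ p.2 < W.η p.1}

theorem isOpen_fluid (W : PeriodicWave g Patm L) : IsOpen W.fluid := by
  have := W.η_smooth.continuous
  exact (isOpen_lt continuous_const continuous_snd).inter
    (isOpen_lt continuous_snd (by fun_prop))

theorem neg_depth_lt_η (W : PeriodicWave g Patm L) (hL : 0 < L) (x : ℝ) : -W.d < W.η x := by
  have hη := W.η_smooth.continuous
  obtain ⟨z, hz⟩ : ∃ z, 0 ≤ W.η z := by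
    by_contra! h
    have := intervalIntegral.intervalIntegral_pos_of_pos (f := fun x => -W.η x)
      ((hη.neg).intervalIntegrable (-L) L) (fun x => by linarith [h x]) (by linarith)
    rw [intervalIntegral.integral_neg, W.η_mean] at this
    simp at this
  by_contra! h
  obtain ⟨t, ht⟩ := mem_range_of_exists_le_of_exists_ge hη ⟨x, h⟩
    ⟨z, (by linarith [W.d_pos] : -W.d ≤ W.η z)⟩
  have h1 := W.psi_surface t
  rw [ht, W.psi_bed t] at h1
  exact W.m_pos.ne' h1

theorem mem_of_isClosed (W : PeriodicWave g Patm L) (hL : 0 < L) {S : Set (ℝ × ℝ)}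
    (hS : IsClosed S) (h : ∀ x y, -W.d < y → y < W.η x → (x, y) ∈ S) (x y : ℝ)
    (h1 : -W.d ≤ y) (h2 : y ≤ W.η x) : (x, y) ∈ S := by
  have hy : y ∈ closure (Ioo (-W.d) (W.η x)) := by
    rw [closure_Ioo (W.neg_depth_lt_η hL x).ne]; exact ⟨h1, h2⟩
  have hc : Continuous fun s : ℝ => (x, s) := by fun_prop
  have := map_mem_closure hc hy (t := S) (fun s hs => h x s hs.1 hs.2)
  rwa [hS.closure_eq] at this

theorem u_neg (W : PeriodicWave g Patm L) {x y : ℝ} (h1 : -W.d ≤ y) (h2 : y ≤ W.η x) :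
    W.u (x, y) < 0 := by
  obtain ⟨δ, hδ, h⟩ := W.nonstagnant
  linarith [h x y h1 h2]

theorem psi_mem_Ioo (W : PeriodicWave g Patm L) {x y : ℝ} (h1 : -W.d < y) (h2 : y < W.η x) :
    W.ψ (x, y) ∈ Ioo 0 W.m := by
  have hd : ∀ s, HasDerivAt (fun s => W.ψ (x, s)) (pdY W.ψ (x, s)) s := fun s =>
    hasDerivAt_slice_snd (W.ψ_smooth.differentiable (by norm_num) _)
  have hanti : StrictAntiOn (fun s => W.ψ (x, s)) (Icc (-W.d) (W.η x)) := by
    apply strictAntiOn_of_deriv_neg (convex_Icc _ _)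
    · exact (continuous_iff_continuousAt.2 fun s => (hd s).continuousAt).continuousOn
    · intro s hs
      rw [interior_Icc] at hs
      rw [(hd s).deriv, W.psi_y x s hs.1.le hs.2.le]
      exact W.u_neg hs.1.le hs.2.le
  have hl : -W.d < W.η x := h1.trans h2
  constructor
  · have := hanti ⟨h1.le, h2.le⟩ ⟨hl.le, le_rfl⟩ h2
    simpa [W.psi_surface] using this
  · have := hanti ⟨le_rfl, hl.le⟩ ⟨h1.le, h2.le⟩ h1
    simpa [W.psi_bed] using this

/-- The derivative `γ'` of the vorticity function, extended by constants outside `[0, m]`. -/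
noncomputable def dγ (W : PeriodicWave g Patm L) (s : ℝ) : ℝ :=
  derivWithin W.γ (Icc 0 W.m) (projIcc 0 W.m W.m_pos.le s)

theorem contDiffOn_derivWithin (W : PeriodicWave g Patm L) :
    ContDiffOn ℝ 1 (derivWithin W.γ (Icc 0 W.m)) (Icc 0 W.m) :=
  W.γ_smooth.derivWithin (uniqueDiffOn_Icc W.m_pos) (by norm_num)

theorem continuous_dγ (W : PeriodicWave g Patm L) : Continuous W.dγ :=
  (W.contDiffOn_derivWithin.continuousOn.domRestrict).comp
    (continuous_projIcc (h := W.m_pos.le))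

theorem dγ_nonpos (W : PeriodicWave g Patm L) (hW : W.MemW) (s : ℝ) : W.dγ s ≤ 0 :=
  hW.2.1 _ (projIcc 0 W.m W.m_pos.le s).2

theorem dγ_of_mem (W : PeriodicWave g Patm L) {s : ℝ} (hs : s ∈ Icc 0 W.m) :
    W.dγ s = derivWithin W.γ (Icc 0 W.m) s := by
  rw [dγ, projIcc_of_mem _ hs]

theorem hasDerivAt_γ (W : PeriodicWave g Patm L) {s : ℝ} (hs : s ∈ Ioo 0 W.m) :
    HasDerivAt W.γ (W.dγ s) s := by
  rw [W.dγ_of_mem (Ioo_subset_Icc_self hs)]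
  exact ((W.γ_smooth.differentiableOn (by norm_num)) s
    (Ioo_subset_Icc_self hs)).hasDerivWithinAt.hasDerivAt (Icc_mem_nhds hs.1 hs.2)

theorem hasDerivAt_dγ (W : PeriodicWave g Patm L) {s : ℝ} (hs : s ∈ Ioo 0 W.m) :
    HasDerivAt W.dγ (derivWithin (derivWithin W.γ (Icc 0 W.m)) (Icc 0 W.m) s) s := by
  have := ((W.contDiffOn_derivWithin.differentiableOn (by norm_num)) s
    (Ioo_subset_Icc_self hs)).hasDerivWithinAt.hasDerivAt (Icc_mem_nhds hs.1 hs.2)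
  refine this.congr_of_eventuallyEq ?_
  filter_upwards [Icc_mem_nhds hs.1 hs.2] with t ht using W.dγ_of_mem ht

/-- The coefficient `γ'(ψ)` of the linearised vorticity equation. -/
noncomputable def coeff (W : PeriodicWave g Patm L) (p : ℝ × ℝ) : ℝ := W.dγ (W.ψ p)

theorem continuous_coeff (W : PeriodicWave g Patm L) : Continuous W.coeff :=
  W.continuous_dγ.comp W.ψ_smooth.continuous

theorem coeff_nonpos (W : PeriodicWave g Patm L) (hW : W.MemW) (p : ℝ × ℝ) : W.coeff p ≤ 0 :=
  W.dγ_nonpos hW _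

theorem eventually_fst (W : PeriodicWave g Patm L) {x y : ℝ} (h1 : -W.d < y) (h2 : y < W.η x) :
    ∀ᶠ s in nhds x, -W.d < y ∧ y < W.η s := by
  have hc : Continuous fun s : ℝ => (s, y) := by fun_prop
  exact hc.continuousAt.preimage_mem_nhds (W.isOpen_fluid.mem_nhds (⟨h1, h2⟩ : (x, y) ∈ W.fluid))

theorem eventually_snd (W : PeriodicWave g Patm L) {x y : ℝ} (h1 : -W.d < y) (h2 : y < W.η x) :
    ∀ᶠ s in nhds y, -W.d < s ∧ s < W.η x := by
  have hc : Continuous fun s : ℝ => (x, s) := by fun_prop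
  exact hc.continuousAt.preimage_mem_nhds (W.isOpen_fluid.mem_nhds (⟨h1, h2⟩ : (x, y) ∈ W.fluid))

section smoothness

variable (W : PeriodicWave g Patm L)

theorem contDiff_ux : ContDiff ℝ 2 (pdX W.u) := W.u_smooth.pdX (by norm_num)
theorem contDiff_uy : ContDiff ℝ 2 (pdY W.u) := W.u_smooth.pdY (by norm_num)
theorem contDiff_vx : ContDiff ℝ 2 (pdX W.v) := W.v_smooth.pdX (by norm_num)
theorem contDiff_vy : ContDiff ℝ 2 (pdY W.v) := W.v_smooth.pdY (by norm_num)
theorem contDiff_two_u : ContDiff ℝ 2 W.u := W.u_smooth.of_le (by norm_num)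
theorem contDiff_two_v : ContDiff ℝ 2 W.v := W.v_smooth.of_le (by norm_num)

theorem differentiable_u : Differentiable ℝ W.u := W.u_smooth.differentiable (by norm_num)
theorem differentiable_v : Differentiable ℝ W.v := W.v_smooth.differentiable (by norm_num)
theorem differentiable_ψ : Differentiable ℝ W.ψ := W.ψ_smooth.differentiable (by norm_num)
theorem differentiable_ux : Differentiable ℝ (pdX W.u) :=
  W.contDiff_ux.differentiable (by norm_num)
theorem differentiable_uy : Differentiable ℝ (pdY W.u) :=
  W.contDiff_uy.differentiable (by norm_num)
theorem differentiable_vx : Differentiable ℝ (pdX W.v) :=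
  W.contDiff_vx.differentiable (by norm_num)
theorem differentiable_vy : Differentiable ℝ (pdY W.v) :=
  W.contDiff_vy.differentiable (by norm_num)

theorem ux_comm : pdX (pdY W.u) = pdY (pdX W.u) := (pdY_pdX_comm W.contDiff_two_u).symm
theorem vx_comm : pdX (pdY W.v) = pdY (pdX W.v) := (pdY_pdX_comm W.contDiff_two_v).symm

variable {W} {x y : ℝ}

theorem second_order_div_x (h1 : -W.d < y) (h2 : y < W.η x) :
    pdX (pdX W.u) (x, y) + pdY (pdX W.v) (x, y) = 0 := by
  rw [← vx_comm]
  have h := (hasDerivAt_slice_fst (W.differentiable_ux (x, y))).fun_add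
    (hasDerivAt_slice_fst (W.differentiable_vy (x, y)))
  refine h.unique ((hasDerivAt_const x (0 : ℝ)).congr_of_eventuallyEq ?_)
  filter_upwards [W.eventually_fst h1 h2] with s hs using W.incompressible s y hs.1 hs.2

theorem second_order_div_y (h1 : -W.d < y) (h2 : y < W.η x) :
    pdY (pdX W.u) (x, y) + pdY (pdY W.v) (x, y) = 0 := by
  have h := (hasDerivAt_slice_snd (W.differentiable_ux (x, y))).fun_add
    (hasDerivAt_slice_snd (W.differentiable_vy (x, y)))
  refine h.unique ((hasDerivAt_const y (0 : ℝ)).congr_of_eventuallyEq ?_)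
  filter_upwards [W.eventually_snd h1 h2] with s hs using W.incompressible x s hs.1 hs.2

theorem second_order_vort_x (h1 : -W.d < y) (h2 : y < W.η x) :
    pdX (pdX W.v) (x, y) - pdY (pdX W.u) (x, y) = -(W.coeff (x, y) * W.v (x, y)) := by
  rw [← ux_comm]
  have h := (hasDerivAt_slice_fst (W.differentiable_vx (x, y))).fun_sub
    (hasDerivAt_slice_fst (W.differentiable_uy (x, y)))
  have h' := (W.hasDerivAt_γ (W.psi_mem_Ioo h1 h2)).comp x
    (hasDerivAt_slice_fst (W.differentiable_ψ (x, y)))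
  rw [W.psi_x x y h1.le h2.le] at h'
  have e : W.dγ (W.ψ (x, y)) * -W.v (x, y) = -(W.coeff (x, y) * W.v (x, y)) := by
    rw [coeff]; ring
  rw [e] at h'
  refine h.unique (h'.congr_of_eventuallyEq ?_)
  filter_upwards [W.eventually_fst h1 h2] with s hs using W.vorticity_eq s y hs.1 hs.2

theorem second_order_vort_y (h1 : -W.d < y) (h2 : y < W.η x) :
    pdY (pdX W.v) (x, y) - pdY (pdY W.u) (x, y) = W.coeff (x, y) * W.u (x, y) := by
  have h := (hasDerivAt_slice_snd (W.differentiable_vx (x, y))).fun_sub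
    (hasDerivAt_slice_snd (W.differentiable_uy (x, y)))
  have h' := (W.hasDerivAt_γ (W.psi_mem_Ioo h1 h2)).comp y
    (hasDerivAt_slice_snd (W.differentiable_ψ (x, y)))
  rw [W.psi_y x y h1.le h2.le] at h'
  refine h.unique (h'.congr_of_eventuallyEq ?_)
  filter_upwards [W.eventually_snd h1 h2] with s hs using W.vorticity_eq x s hs.1 hs.2

theorem lap_u (h1 : -W.d < y) (h2 : y < W.η x) :
    lap W.u (x, y) = -(W.coeff (x, y) * W.u (x, y)) := by
  unfold lap
  linarith [second_order_div_x h1 h2, second_order_vort_y h1 h2]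

theorem lap_v (h1 : -W.d < y) (h2 : y < W.η x) :
    lap W.v (x, y) = -(W.coeff (x, y) * W.v (x, y)) := by
  unfold lap
  linarith [second_order_div_y h1 h2, second_order_vort_x h1 h2]

theorem lap_ux (h1 : -W.d < y) (h2 : y < W.η x) :
    lap (pdX W.u) (x, y) + W.coeff (x, y) * pdX W.u (x, y) =
    derivWithin (derivWithin W.γ (Icc 0 W.m)) (Icc 0 W.m) (W.ψ (x, y)) *
      (W.u (x, y) * W.v (x, y)) := by
  have hxx : ContDiff ℝ 1 (pdX (pdX W.u)) := contDiff_one_pdX W.contDiff_ux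
  have hyy : ContDiff ℝ 1 (pdY (pdY W.u)) := contDiff_one_pdY W.contDiff_uy
  have h := (hasDerivAt_slice_fst (hxx.differentiable one_ne_zero (x, y))).fun_add
    (hasDerivAt_slice_fst (hyy.differentiable one_ne_zero (x, y)))
  have h' := (((W.hasDerivAt_dγ (W.psi_mem_Ioo h1 h2)).comp x
    (hasDerivAt_slice_fst (W.differentiable_ψ (x, y)))).fun_mul
    (hasDerivAt_slice_fst (W.differentiable_u (x, y)))).fun_neg
  rw [W.psi_x x y h1.le h2.le] at h'
  have e := h.unique (h'.congr_of_eventuallyEq (by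
    filter_upwards [W.eventually_fst h1 h2] with s hs using lap_u hs.1 hs.2))
  have e2 : pdY (pdY (pdX W.u)) = pdX (pdY (pdY W.u)) := by
    rw [← ux_comm, pdY_pdX_comm W.contDiff_uy]
  unfold lap
  rw [e2, e, coeff]
  simp only [Function.comp]
  ring

end smoothness

end PeriodicWave

theorem deriv_eq_zero_of_reflection {φ : ℝ → ℝ} {d a : ℝ} (h : HasDerivAt φ d a)
    (hs : ∀ s, φ (2 * a - s) = φ s) : d = 0 := by
  have h' : HasDerivAt φ d (2 * a - a) := by rwa [two_mul, add_sub_cancel_right]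
  have h2 := h'.comp a ((hasDerivAt_id' a).const_sub (2 * a))
  have e : (φ ∘ fun s => 2 * a - s) = φ := funext hs
  rw [e] at h2
  linarith [h.unique h2]

theorem ContDiff.exists_quadratic_bound {η : ℝ → ℝ} (hη : ContDiff ℝ 2 η) (x₀ : ℝ) :
    ∃ C > 0, ∃ r > 0, ∀ x, |x - x₀| < r →
      |η x - η x₀ - deriv η x₀ * (x - x₀)| ≤ C * (x - x₀) ^ 2 := by
  have hd : Differentiable ℝ η := hη.differentiable (by norm_num)
  have hd1 : Differentiable ℝ (deriv η) := by
    have : ContDiff ℝ 1 (deriv η) := by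
      have := (contDiff_succ_iff_deriv (n := 1)).1 (by simpa [one_add_one_eq_two] using hη)
      exact this.2.2
    exact this.differentiable one_ne_zero
  obtain ⟨C, hC⟩ := (hd1 x₀).isBigO_sub.bound
  obtain ⟨r, hr, hball⟩ := Metric.eventually_nhds_iff.1 hC
  refine ⟨|C| + 1, by positivity, r, hr, fun x hx => ?_⟩
  have key := Convex.norm_image_sub_le_of_norm_hasDerivWithin_le (𝕜 := ℝ)
    (f := fun t => η t - deriv η x₀ * t) (f' := fun t => deriv η t - deriv η x₀)
    (s := Icc (x₀ - |x - x₀|) (x₀ + |x - x₀|)) (x := x₀) (y := x) (C := (|C| + 1) * |x - x₀|)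
    (fun t _ => by
      have := (hd t).hasDerivAt.fun_sub ((hasDerivAt_id' t).const_mul (deriv η x₀))
      simpa using this.hasDerivWithinAt)
    (fun t ht => by
      have ht' : |t - x₀| ≤ |x - x₀| := abs_le.2 ⟨by linarith [ht.1], by linarith [ht.2]⟩
      have h1 := hball (y := t) (by rw [Real.dist_eq]; exact ht'.trans_lt hx)
      rw [Real.norm_eq_abs, Real.norm_eq_abs] at h1
      rw [Real.norm_eq_abs]
      refine h1.trans ?_
      exact mul_le_mul (by linarith [le_abs_self C]) ht' (abs_nonneg _) (by positivity))
    (convex_Icc _ _) ⟨by linarith [abs_nonneg (x - x₀)], by linarith [abs_nonneg (x - x₀)]⟩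
    ⟨by linarith [neg_abs_le (x - x₀)], by linarith [le_abs_self (x - x₀)]⟩
  rw [Real.norm_eq_abs, Real.norm_eq_abs, mul_assoc, ← sq, sq_abs] at key
  convert key using 2
  ring

namespace PeriodicWave

variable {g Patm L : ℝ}

/-- The surface admits an interior touching disc at each of its points. -/
theorem exists_interior_disc (W : PeriodicWave g Patm L) (hL : 0 < L) (x₀ : ℝ) {ρ : ℝ}
    (hρ : 0 < ρ) : ∃ R > 0,
      (∀ p, sqDist (x₀ + R * deriv W.η x₀) (W.η x₀ - R) p ≤ R ^ 2 * (1 + deriv W.η x₀ ^ 2) →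
        |p.1 - x₀| < ρ ∧ -W.d < p.2 ∧ p.2 ≤ W.η p.1) ∧
      (∀ p, sqDist (x₀ + R * deriv W.η x₀) (W.η x₀ - R) p < R ^ 2 * (1 + deriv W.η x₀ ^ 2) →
        p.2 < W.η p.1) := by
  obtain ⟨C, hC, r, hr, hq⟩ := (W.η_smooth.of_le (m := 2) (by norm_num)).exists_quadratic_bound x₀
  set s := deriv W.η x₀
  set T := 1 + s ^ 2 with hT
  have hT1 : 1 ≤ T := by nlinarith [sq_nonneg s]
  have hdep : 0 < W.η x₀ + W.d := by linarith [W.neg_depth_lt_η hL x₀]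
  set μ := min (min ρ r) (min (W.η x₀ + W.d) (1 / C)) with hμ
  have hμ0 : 0 < μ := by positivity
  have hμ1 : μ ≤ ρ := (min_le_left _ _).trans (min_le_left _ _)
  have hμ2 : μ ≤ r := (min_le_left _ _).trans (min_le_right _ _)
  have hμ3 : μ ≤ W.η x₀ + W.d := (min_le_right _ _).trans (min_le_left _ _)
  have hμ4 : μ ≤ 1 / C := (min_le_right _ _).trans (min_le_right _ _)
  set R := μ / (4 * T) with hR
  have hR0 : 0 < R := by positivity
  have hRT : 2 * R * T = μ / 2 := by rw [hR]; field_simp; ring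
  have hRC : 2 * R * C ≤ 1 := by
    have h1 : μ * C ≤ 1 := by rwa [le_div_iff₀ hC] at hμ4
    have h2 : 2 * R ≤ μ := by nlinarith
    nlinarith
  have size : ∀ X Y : ℝ, X ^ 2 + Y ^ 2 ≤ 2 * R * (s * X - Y) → |X| < μ ∧ |Y| < μ := by
    intro X Y h
    have h1 : X ^ 2 + Y ^ 2 ≤ (μ / 2) ^ 2 := by
      have e1 : X ^ 2 + Y ^ 2 ≤ 4 * R ^ 2 * T := by
        rw [hT]
        linarith [sq_nonneg (X - 2 * R * s), sq_nonneg (Y + 2 * R)]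
      have e2 : 4 * R ^ 2 * T ≤ (2 * R * T) ^ 2 := by
        have : 0 ≤ 4 * R ^ 2 * T * (T - 1) :=
          mul_nonneg (by positivity) (by linarith)
        linarith
      rw [← hRT]; linarith
    have hX := abs_le_of_sq_le_sq (show X ^ 2 ≤ (μ / 2) ^ 2 by nlinarith [sq_nonneg Y])
      (by positivity)
    have hY := abs_le_of_sq_le_sq (show Y ^ 2 ≤ (μ / 2) ^ 2 by nlinarith [sq_nonneg X])
      (by positivity)
    constructor
    · exact hX.trans_lt (by linarith)
    · exact hY.trans_lt (by linarith)
  have expand : ∀ p : ℝ × ℝ, sqDist (x₀ + R * s) (W.η x₀ - R) p - R ^ 2 * T =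
      (p.1 - x₀) ^ 2 + (p.2 - W.η x₀) ^ 2
        - 2 * R * (s * (p.1 - x₀) - (p.2 - W.η x₀)) := by
    intro p; simp only [sqDist, hT]; ring
  have gap : ∀ p : ℝ × ℝ, |p.1 - x₀| < μ →
      2 * R * (s * (p.1 - x₀) - (p.2 - W.η x₀)) - (p.1 - x₀) ^ 2 ≤ 2 * R * (W.η p.1 - p.2) := by
    intro p hp
    have h1 := (abs_le.1 (hq p.1 (hp.trans_le hμ2))).1
    nlinarith [mul_le_mul_of_nonneg_right hRC (sq_nonneg (p.1 - x₀)),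
      mul_le_mul_of_nonneg_left h1 hR0.le]
  refine ⟨R, hR0, fun p hp => ?_, fun p hp => ?_⟩
  · have e := expand p
    obtain ⟨h1, h2⟩ := size (p.1 - x₀) (p.2 - W.η x₀) (by linarith)
    refine ⟨h1.trans_le hμ1, by linarith [(abs_lt.1 h2).1], ?_⟩
    nlinarith [gap p h1, sq_nonneg (p.2 - W.η x₀)]
  · have e := expand p
    obtain ⟨h1, h2⟩ := size (p.1 - x₀) (p.2 - W.η x₀) (by linarith)
    nlinarith [gap p h1, sq_nonneg (p.2 - W.η x₀)]

/-! ### Symmetry -/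

theorem v_crest_line (W : PeriodicWave g Patm L) (y : ℝ) : W.v (0, y) = 0 := by
  have := W.v_odd 0 y
  rw [neg_zero] at this
  linarith

theorem v_trough_line (W : PeriodicWave g Patm L) (y : ℝ) : W.v (L, y) = 0 := by
  have h1 := W.v_odd L y
  have h2 := W.v_periodic (-L) y
  rw [show -L + 2 * L = L by ring] at h2
  linarith

theorem ux_crest_line (W : PeriodicWave g Patm L) (y : ℝ) : pdX W.u (0, y) = 0 :=
  deriv_eq_zero_of_reflection (hasDerivAt_slice_fst (W.differentiable_u (0, y)))
    fun s => by simpa using W.u_even s y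

theorem ux_trough_line (W : PeriodicWave g Patm L) (y : ℝ) : pdX W.u (L, y) = 0 :=
  deriv_eq_zero_of_reflection (hasDerivAt_slice_fst (W.differentiable_u (L, y)))
    fun s => by
      rw [← W.u_even s y, ← W.u_periodic (-s) y]
      congr 2; ring

theorem uxy_crest_line (W : PeriodicWave g Patm L) (y : ℝ) : pdY (pdX W.u) (0, y) = 0 := by
  have h := hasDerivAt_slice_snd (W.differentiable_ux (0, y))
  exact h.unique ((hasDerivAt_const y (0 : ℝ)).congr_of_eventuallyEq
    (Filter.Eventually.of_forall W.ux_crest_line))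

theorem differentiable_η (W : PeriodicWave g Patm L) : Differentiable ℝ W.η :=
  W.η_smooth.differentiable (by norm_num)

theorem deriv_η_zero (W : PeriodicWave g Patm L) : deriv W.η 0 = 0 :=
  deriv_eq_zero_of_reflection (W.differentiable_η 0).hasDerivAt
    fun s => by simpa using W.η_even s

/-! ### The closed half period -/

/-- The closure of the half period of the fluid domain. -/
def halfBar (W : PeriodicWave g Patm L) : Set (ℝ × ℝ) :=
  {p | 0 ≤ p.1 ∧ p.1 ≤ L ∧ -W.d ≤ p.2 ∧ p.2 ≤ W.η p.1}

theorem isCompact_halfBar (W : PeriodicWave g Patm L) (hL : 0 < L) : IsCompact W.halfBar := by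
  have hη := W.η_smooth.continuous
  have : W.halfBar = (fun q : ℝ × ℝ => (q.1, -W.d + q.2 * (W.η q.1 + W.d))) ''
      (Icc 0 L ×ˢ Icc 0 1) := by
    ext ⟨x, y⟩
    have hpos : 0 < W.η x + W.d := by linarith [W.neg_depth_lt_η hL x]
    constructor
    · rintro ⟨h1, h2, h3, h4⟩
      simp only at h1 h2 h3 h4
      refine ⟨(x, (y + W.d) / (W.η x + W.d)), ⟨⟨h1, h2⟩, ?_, ?_⟩, ?_⟩
      · exact div_nonneg (by linarith) hpos.le
      · simp only; rw [div_le_one hpos]; linarith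
      · ext <;> simp; field_simp; ring
    · rintro ⟨⟨x', t⟩, ⟨⟨h1, h2⟩, h3, h4⟩, he⟩
      obtain ⟨rfl, rfl⟩ := Prod.mk_inj.1 he
      simp only at h1 h2 h3 h4
      exact ⟨h1, h2, by simp only; nlinarith, by simp only; nlinarith⟩
  rw [this]
  exact (isCompact_Icc.prod isCompact_Icc).image (by fun_prop)

theorem isOpen_Ωplus (W : PeriodicWave g Patm L) : IsOpen W.Ωplus := by
  have hη := W.η_smooth.continuous
  exact (isOpen_lt continuous_const continuous_fst).inter
    ((isOpen_lt continuous_fst continuous_const).inter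
      ((isOpen_lt continuous_const continuous_snd).inter (isOpen_lt continuous_snd (by fun_prop))))

theorem isPreconnected_Ωplus (W : PeriodicWave g Patm L) (hL : 0 < L) :
    IsPreconnected W.Ωplus := by
  have hη := W.η_smooth.continuous
  have : W.Ωplus = (fun q : ℝ × ℝ => (q.1, -W.d + q.2 * (W.η q.1 + W.d))) ''
      (Ioo 0 L ×ˢ Ioo 0 1) := by
    ext ⟨x, y⟩
    have hpos : 0 < W.η x + W.d := by linarith [W.neg_depth_lt_η hL x]
    constructor
    · rintro ⟨h1, h2, h3, h4⟩
      simp only at h1 h2 h3 h4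
      refine ⟨(x, (y + W.d) / (W.η x + W.d)), ⟨⟨h1, h2⟩, ?_, ?_⟩, ?_⟩
      · exact div_pos (by linarith) hpos
      · simp only; rw [div_lt_one hpos]; linarith
      · ext <;> simp; field_simp; ring
    · rintro ⟨⟨x', t⟩, ⟨⟨h1, h2⟩, h3, h4⟩, he⟩
      obtain ⟨rfl, rfl⟩ := Prod.mk_inj.1 he
      simp only at h1 h2 h3 h4
      exact ⟨h1, h2, by simp only; nlinarith, by simp only; nlinarith⟩
  rw [this]
  exact (isPreconnected_Ioo.prod isPreconnected_Ioo).image _ (by fun_prop)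

theorem Ωplus_subset_halfBar (W : PeriodicWave g Patm L) : W.Ωplus ⊆ W.halfBar :=
  fun _ h => ⟨h.1.le, h.2.1.le, h.2.2.1.le, h.2.2.2.le⟩

theorem exists_coeff_bound (W : PeriodicWave g Patm L) (hL : 0 < L) :
    ∃ M, ∀ p ∈ W.halfBar, -M ≤ W.coeff p := by
  obtain ⟨B, hB⟩ := (W.isCompact_halfBar hL).bddBelow_image W.continuous_coeff.continuousOn
  exact ⟨-B, fun p hp => by rw [neg_neg]; exact hB ⟨p, hp, rfl⟩⟩

/-- The boundary of the half period consists of the bed, the surface and the two vertical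
sides. -/
theorem boundary_cases (W : PeriodicWave g Patm L) {x y : ℝ}
    (hp : (x, y) ∈ W.halfBar \ W.Ωplus) : x = 0 ∨ x = L ∨ y = -W.d ∨ y = W.η x := by
  obtain ⟨⟨h1, h2, h3, h4⟩, hn⟩ := hp
  simp only at h1 h2 h3 h4
  by_contra! h
  exact hn ⟨lt_of_le_of_ne h1 h.1.symm, lt_of_le_of_ne h2 h.2.1,
    lt_of_le_of_ne h3 h.2.2.1.symm, lt_of_le_of_ne h4 h.2.2.2⟩

theorem MonotoneHalf.v_nonneg {W : PeriodicWave g Patm L} (hm : W.MonotoneHalf) {x y : ℝ}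
    (hp : (x, y) ∈ W.halfBar) : 0 ≤ W.v (x, y) := by
  by_cases hU : (x, y) ∈ W.Ωplus
  · exact (hm _ (Or.inl hU)).le
  · rcases W.boundary_cases ⟨hp, hU⟩ with rfl | rfl | rfl | h
    · rw [v_crest_line]
    · rw [v_trough_line]
    · rw [W.bed_kinematic]
    · by_cases h0 : x = 0
      · rw [h0, v_crest_line]
      by_cases h1 : x = L
      · rw [h1, v_trough_line]
      exact (hm _ (Or.inr ⟨lt_of_le_of_ne hp.1 (Ne.symm h0), lt_of_le_of_ne hp.2.1 h1, h⟩)).le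

theorem incompressible_closure (W : PeriodicWave g Patm L) (hL : 0 < L) {x y : ℝ}
    (h1 : -W.d ≤ y) (h2 : y ≤ W.η x) : pdX W.u (x, y) + pdY W.v (x, y) = 0 :=
  W.mem_of_isClosed hL (S := {p | pdX W.u p + pdY W.v p = 0})
    (isClosed_eq (W.contDiff_ux.continuous.add W.contDiff_vy.continuous) continuous_const)
    W.incompressible x y h1 h2

theorem lap_ux_nonneg {W : PeriodicWave g Patm L} (hW : W.MemW) (hm : W.MonotoneHalf)
    {p : ℝ × ℝ} (hp : p ∈ W.Ωplus) :
    0 ≤ lap (pdX W.u) p + W.coeff p * pdX W.u p := by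
  obtain ⟨x, y⟩ := p
  rw [lap_ux hp.2.2.1 hp.2.2.2]
  apply mul_nonneg_of_nonpos_of_nonpos
  · exact hW.2.2.1 _ (Ioo_subset_Icc_self (W.psi_mem_Ioo hp.2.2.1 hp.2.2.2))
  · exact mul_nonpos_of_nonpos_of_nonneg (W.u_neg hp.2.2.1.le hp.2.2.2.le).le
      (hm _ (Or.inl hp)).le

theorem ux_nonpos {W : PeriodicWave g Patm L} (hL : 0 < L) (hW : W.MemW)
    (hm : W.MonotoneHalf) (hux : ∀ x, 0 ≤ x → x ≤ L → pdX W.u (x, W.η x) ≤ 0) :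
    ∀ p ∈ W.halfBar, pdX W.u p ≤ 0 := by
  obtain ⟨M, hM⟩ := W.exists_coeff_bound hL
  have hbd : ∀ p ∈ W.halfBar \ W.Ωplus, pdX W.u p ≤ 0 := by
    rintro ⟨x, y⟩ hp
    rcases W.boundary_cases hp with rfl | rfl | rfl | rfl
    · rw [ux_crest_line]
    · rw [ux_trough_line]
    · have h1 := (hasDerivAt_slice_snd (W.differentiable_v (x, -W.d))).fun_neg
      have h2 := h1.nonpos_of_le_right (W.neg_depth_lt_η hL x) (by
        intro t ht ht'
        rw [W.bed_kinematic]
        linarith [hm.v_nonneg (x := x) (y := t) ⟨hp.1.1, hp.1.2.1, ht.le, ht'⟩])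
      linarith [W.incompressible_closure hL le_rfl (W.neg_depth_lt_η hL x).le]
    · exact hux x hp.1.1 hp.1.2.1
  have hin := nonpos_of_nonpos_boundary (W.isCompact_halfBar hL) W.isOpen_Ωplus
    W.Ωplus_subset_halfBar W.contDiff_ux (fun p _ => W.coeff_nonpos hW p)
    (fun p hp => hM p (W.Ωplus_subset_halfBar hp)) (fun p hp => lap_ux_nonneg hW hm hp) hbd
  intro p hp
  by_cases h : p ∈ W.Ωplus
  · exact hin p h
  · exact hbd p ⟨hp, h⟩

theorem ux_neg {W : PeriodicWave g Patm L} (hL : 0 < L) (hW : W.MemW)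
    (hm : W.MonotoneHalf) (hux : ∀ x, 0 ≤ x → x ≤ L → pdX W.u (x, W.η x) ≤ 0) :
    ∀ p ∈ W.Ωplus, pdX W.u p < 0 := by
  obtain ⟨M, hM⟩ := W.exists_coeff_bound hL
  refine strong_maximum_principle W.isOpen_Ωplus (W.isPreconnected_Ωplus hL) W.contDiff_ux
    (fun p _ => W.coeff_nonpos hW p)
    (fun p hp => hM p (W.Ωplus_subset_halfBar hp)) (fun p hp => lap_ux_nonneg hW hm hp)
    (fun p hp => ux_nonpos hL hW hm hux p (W.Ωplus_subset_halfBar hp)) ?_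
  have hl := W.neg_depth_lt_η hL (L / 2)
  obtain ⟨y, hy, he⟩ := exists_hasDerivAt_eq_slope (fun s => W.v (L / 2, s))
    (fun s => pdY W.v (L / 2, s)) hl
    (by have := W.v_smooth.continuous; fun_prop)
    (fun s _ => hasDerivAt_slice_snd (W.differentiable_v _))
  refine ⟨(L / 2, y), ⟨by simp only; linarith, by simp only; linarith, hy.1, hy.2⟩, ?_⟩
  have h1 : 0 < pdY W.v (L / 2, y) := by
    rw [he, W.bed_kinematic, sub_zero]
    exact div_pos (hm _ (Or.inr ⟨by simp only; linarith, by simp only; linarith, rfl⟩))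
      (by linarith)
  linarith [W.incompressible (L / 2) y hy.1 hy.2]

/-- Hopf's lemma for `u_x` at a point of the surface, in the direction of the outer normal. -/
theorem hopf_surface {W : PeriodicWave g Patm L} (hL : 0 < L) (hW : W.MemW)
    (hm : W.MonotoneHalf) (hux : ∀ x, 0 ≤ x → x ≤ L → pdX W.u (x, W.η x) ≤ 0)
    {x : ℝ} (h0 : 0 < x) (h1 : x < L) (h : pdX W.u (x, W.η x) = 0) :
    0 < -deriv W.η x * pdX (pdX W.u) (x, W.η x) + pdY (pdX W.u) (x, W.η x) := by
  obtain ⟨M, hM⟩ := W.exists_coeff_bound hL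
  obtain ⟨R, hR, hd1, hd2⟩ := W.exists_interior_disc hL x (lt_min h0 (sub_pos.2 h1))
  set s := deriv W.η x
  have hsq : Real.sqrt (R ^ 2 * (1 + s ^ 2)) ^ 2 = R ^ 2 * (1 + s ^ 2) :=
    Real.sq_sqrt (by positivity)
  have hx : ∀ p : ℝ × ℝ, |p.1 - x| < min x (L - x) → 0 < p.1 ∧ p.1 < L := fun p hp => by
    have h2 := abs_lt.1 (hp.trans_le (min_le_left _ _))
    have h3 := abs_lt.1 (hp.trans_le (min_le_right _ _))
    exact ⟨by linarith [h2.1], by linarith [h3.2]⟩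
  have key := hopf_lemma (f := pdX W.u) (c := W.coeff) (x₀ := x + R * s) (y₀ := W.η x - R)
    (R := Real.sqrt (R ^ 2 * (1 + s ^ 2))) (M := M) (q := (x, W.η x))
    (Real.sqrt_pos.2 (by positivity)) W.contDiff_ux
    (fun p hp => by
      rw [hsq] at hp
      obtain ⟨h2, h3, h4⟩ := hd1 p hp.le
      have hp' : p ∈ W.Ωplus := ⟨(hx p h2).1, (hx p h2).2, h3, hd2 p hp⟩
      exact ⟨ux_neg hL hW hm hux p hp', W.coeff_nonpos hW p, hM p (W.Ωplus_subset_halfBar hp'),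
        lap_ux_nonneg hW hm hp'⟩)
    (fun p hp => by
      rw [hsq] at hp
      obtain ⟨h2, h3, h4⟩ := hd1 p hp.le
      exact ux_nonpos hL hW hm hux p ⟨(hx p h2).1.le, (hx p h2).2.le, h3.le, h4⟩)
    (by rw [hsq]; simp only [sqDist]; ring) h
  simp only at key
  have e : R * (-s * pdX (pdX W.u) (x, W.η x) + pdY (pdX W.u) (x, W.η x)) > 0 := by linarith
  exact (pos_iff_pos_of_mul_pos e).1 hR

theorem uxx_crest_line_neg {W : PeriodicWave g Patm L} (hL : 0 < L) (hW : W.MemW)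
    (hm : W.MonotoneHalf) (hux : ∀ x, 0 ≤ x → x ≤ L → pdX W.u (x, W.η x) ≤ 0)
    {y : ℝ} (h1 : -W.d < y) (h2 : y < W.η 0) :
    pdX (pdX W.u) (0, y) < 0 := by
  obtain ⟨M, hM⟩ := W.exists_coeff_bound hL
  obtain ⟨ε, hε, hball⟩ := Metric.isOpen_iff.1 W.isOpen_fluid (0, y) ⟨h1, h2⟩
  set ρ := min ε L / 4 with hρ
  have hρ0 : 0 < ρ := by positivity
  have hρε : 4 * ρ ≤ ε := by rw [hρ]; linarith [min_le_left ε L]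
  have hρL : 4 * ρ ≤ L := by rw [hρ]; linarith [min_le_right ε L]
  have loc : ∀ p, sqDist ρ y p ≤ ρ ^ 2 → 0 ≤ p.1 ∧ p.1 < L ∧ p ∈ W.fluid := by
    intro p hp
    have h3 := Metric.mem_closedBall.1 (sqDist_le_subset_closedBall hρ0.le hp)
    rw [Prod.dist_eq, Real.dist_eq, Real.dist_eq] at h3
    have h4 := abs_le.1 ((le_max_left _ _).trans h3)
    have h5 := (le_max_right _ _).trans h3
    simp only at h4 h5
    refine ⟨by linarith [h4.1], by linarith [h4.2], hball ?_⟩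
    rw [Metric.mem_ball, Prod.dist_eq, Real.dist_eq, Real.dist_eq]
    refine max_lt ?_ (by simp only; linarith)
    simp only [sub_zero]
    exact abs_lt.2 ⟨by linarith [h4.1], by linarith [h4.2]⟩
  have key := hopf_lemma (f := pdX W.u) (c := W.coeff) (x₀ := ρ) (y₀ := y)
    (R := ρ) (M := M) (q := (0, y)) hρ0 W.contDiff_ux
    (fun p hp => by
      obtain ⟨h3, h4, h5⟩ := loc p hp.le
      have h6 : 0 < p.1 := by
        rcases h3.eq_or_lt with h | h
        · simp only [sqDist, ← h] at hp
          nlinarith [sq_nonneg (p.2 - y)]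
        · exact h
      have hp' : p ∈ W.Ωplus := ⟨h6, h4, h5.1, h5.2⟩
      exact ⟨ux_neg hL hW hm hux p hp', W.coeff_nonpos hW p, hM p (W.Ωplus_subset_halfBar hp'),
        lap_ux_nonneg hW hm hp'⟩)
    (fun p hp => by
      obtain ⟨h3, h4, h5⟩ := loc p hp.le
      exact ux_nonpos hL hW hm hux p ⟨h3, h4.le, h5.1.le, h5.2.le⟩)
    (by simp [sqDist]) (W.ux_crest_line y)
  simp only [sub_self, zero_mul, add_zero, zero_sub] at key
  nlinarith

theorem uxxy_crest_pos {W : PeriodicWave g Patm L} (hL : 0 < L) (hW : W.MemW)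
    (hm : W.MonotoneHalf) (hux : ∀ x, 0 ≤ x → x ≤ L → pdX W.u (x, W.η x) ≤ 0)
    (h : pdX (pdX W.u) (0, W.η 0) = 0) :
    0 < pdY (pdX (pdX W.u)) (0, W.η 0) := by
  obtain ⟨M, hM⟩ := W.exists_coeff_bound hL
  obtain ⟨R, hR, hd1, hd2⟩ := W.exists_interior_disc hL 0 hL
  rw [W.deriv_η_zero] at hd1 hd2
  simp only [mul_zero, add_zero, ne_eq, OfNat.ofNat_ne_zero, not_false_eq_true, zero_pow, mul_one,
    sub_zero] at hd1 hd2
  refine serrin_corner (c := W.coeff) (M := M) hR W.contDiff_ux ?_ ?_ W.ux_crest_line ?_ h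
  · intro p hp hp0
    obtain ⟨h2, h3, h4⟩ := hd1 p hp.le
    have hp' : p ∈ W.Ωplus := ⟨hp0, (abs_lt.1 h2).2, h3, hd2 p hp⟩
    exact ⟨ux_neg hL hW hm hux p hp', W.coeff_nonpos hW p, hM p (W.Ωplus_subset_halfBar hp'),
      lap_ux_nonneg hW hm hp'⟩
  · intro p hp hp0
    obtain ⟨h2, h3, h4⟩ := hd1 p hp.le
    exact ux_nonpos hL hW hm hux p ⟨hp0.le, (abs_lt.1 h2).2.le, h3.le, h4⟩
  · intro y hy
    have hN : sqDist 0 (W.η 0 - R) (0, y) < R ^ 2 := by simpa [sqDist] using hy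
    exact uxx_crest_line_neg hL hW hm hux (hd1 _ hN.le).2.1 (hd2 _ hN)

end PeriodicWave

/-! ### Identities on the free surface -/

namespace PeriodicWave

variable {g Patm L : ℝ}

section surface

variable (W : PeriodicWave g Patm L)

theorem hasDerivAt_surface {f : ℝ × ℝ → ℝ} (hf : Differentiable ℝ f) (x : ℝ) :
    HasDerivAt (fun s => f (s, W.η s))
      (pdX f (x, W.η x) + deriv W.η x * pdY f (x, W.η x)) x := by
  simpa using hasDerivAt_comp_curve (a := fun s => s) (b := W.η) (hf _) (hasDerivAt_id x)
    (W.differentiable_η x).hasDerivAt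

theorem u_surface_neg (hL : 0 < L) (x : ℝ) : W.u (x, W.η x) < 0 :=
  W.u_neg (W.neg_depth_lt_η hL x).le le_rfl

theorem mem_surface_of_isClosed (hL : 0 < L) {S : Set (ℝ × ℝ)} (hS : IsClosed S)
    (h : ∀ x y, -W.d < y → y < W.η x → (x, y) ∈ S) (x : ℝ) : (x, W.η x) ∈ S :=
  W.mem_of_isClosed hL hS h x (W.η x) (W.neg_depth_lt_η hL x).le le_rfl

theorem coeff_surface (x : ℝ) : W.coeff (x, W.η x) = W.dγ 0 := by
  rw [coeff, W.psi_surface]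

theorem euler_x_surface (hL : 0 < L) (x : ℝ) :
    W.u (x, W.η x) * pdX W.u (x, W.η x) + W.v (x, W.η x) * pdY W.u (x, W.η x) =
      -pdX W.P (x, W.η x) := by
  have hP : ContDiff ℝ 2 (pdX W.P) := W.P_smooth.pdX (by norm_num)
  exact W.mem_surface_of_isClosed hL
    (S := {p | W.u p * pdX W.u p + W.v p * pdY W.u p = -pdX W.P p})
    (isClosed_eq ((W.u_smooth.continuous.mul W.contDiff_ux.continuous).add
      (W.v_smooth.continuous.mul W.contDiff_uy.continuous)) hP.continuous.neg)
    W.euler_x x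

theorem euler_y_surface (hL : 0 < L) (x : ℝ) :
    W.u (x, W.η x) * pdX W.v (x, W.η x) + W.v (x, W.η x) * pdY W.v (x, W.η x) =
      -pdY W.P (x, W.η x) - g := by
  have hP : ContDiff ℝ 2 (pdY W.P) := W.P_smooth.pdY (by norm_num)
  exact W.mem_surface_of_isClosed hL
    (S := {p | W.u p * pdX W.v p + W.v p * pdY W.v p = -pdY W.P p - g})
    (isClosed_eq ((W.u_smooth.continuous.mul W.contDiff_vx.continuous).add
      (W.v_smooth.continuous.mul W.contDiff_vy.continuous)) (hP.continuous.neg.sub continuous_const))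
    W.euler_y x

theorem vorticity_surface (hL : 0 < L) (x : ℝ) :
    pdX W.v (x, W.η x) - pdY W.u (x, W.η x) = W.γ 0 := by
  have hγ : Continuous fun s => W.γ (projIcc 0 W.m W.m_pos.le s) :=
    (W.γ_smooth.continuousOn.domRestrict).comp (continuous_projIcc (h := W.m_pos.le))
  have h := W.mem_surface_of_isClosed hL
    (S := {p | pdX W.v p - pdY W.u p = W.γ (projIcc 0 W.m W.m_pos.le (W.ψ p))})
    (isClosed_eq (W.contDiff_vx.continuous.sub W.contDiff_uy.continuous)
      (hγ.comp W.ψ_smooth.continuous))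
    (fun x y h1 h2 => by
      rw [mem_ofPred_eq, projIcc_of_mem _ (Ioo_subset_Icc_self (W.psi_mem_Ioo h1 h2))]
      exact W.vorticity_eq x y h1 h2) x
  rw [mem_ofPred_eq, W.psi_surface, projIcc_left] at h
  exact h

theorem second_order_div_x_surface (hL : 0 < L) (x : ℝ) :
    pdX (pdX W.u) (x, W.η x) + pdY (pdX W.v) (x, W.η x) = 0 :=
  W.mem_surface_of_isClosed hL (S := {p | pdX (pdX W.u) p + pdY (pdX W.v) p = 0})
    (isClosed_eq ((contDiff_one_pdX W.contDiff_ux).continuous.add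
      (contDiff_one_pdY W.contDiff_vx).continuous) continuous_const)
    (fun _ _ => second_order_div_x) x

theorem second_order_vort_x_surface (hL : 0 < L) (x : ℝ) :
    pdX (pdX W.v) (x, W.η x) - pdY (pdX W.u) (x, W.η x) = -(W.dγ 0 * W.v (x, W.η x)) := by
  rw [← W.coeff_surface x]
  exact W.mem_surface_of_isClosed hL
    (S := {p | pdX (pdX W.v) p - pdY (pdX W.u) p = -(W.coeff p * W.v p)})
    (isClosed_eq ((contDiff_one_pdX W.contDiff_vx).continuous.sub
      (contDiff_one_pdY W.contDiff_ux).continuous)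
      (W.continuous_coeff.mul W.v_smooth.continuous).neg)
    (fun _ _ => second_order_vort_x) x

theorem second_order_vort_y_surface (hL : 0 < L) (x : ℝ) :
    pdY (pdX W.v) (x, W.η x) - pdY (pdY W.u) (x, W.η x) = W.dγ 0 * W.u (x, W.η x) := by
  rw [← W.coeff_surface x]
  exact W.mem_surface_of_isClosed hL
    (S := {p | pdY (pdX W.v) p - pdY (pdY W.u) p = W.coeff p * W.u p})
    (isClosed_eq ((contDiff_one_pdY W.contDiff_vx).continuous.sub
      (contDiff_one_pdY W.contDiff_uy).continuous)
      (W.continuous_coeff.mul W.u_smooth.continuous))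
    (fun _ _ => second_order_vort_y) x

/-- The quantity `g + u (u_y + v_x)` along the free surface. -/
noncomputable def surfaceQ (W : PeriodicWave g Patm L) (x : ℝ) : ℝ :=
  g + W.u (x, W.η x) * (pdY W.u (x, W.η x) + pdX W.v (x, W.η x))

/-- The product of `u` with the tangential derivative of `surfaceQ`. -/
noncomputable def surfaceG (W : PeriodicWave g Patm L) (x : ℝ) : ℝ :=
  (W.u (x, W.η x) * pdX W.u (x, W.η x) + W.v (x, W.η x) * pdY W.u (x, W.η x)) *
      (pdY W.u (x, W.η x) + pdX W.v (x, W.η x)) +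
    2 * W.u (x, W.η x) * (W.u (x, W.η x) * pdY (pdX W.u) (x, W.η x) -
      W.v (x, W.η x) * pdX (pdX W.u) (x, W.η x) -
      W.dγ 0 * (W.u (x, W.η x) * W.v (x, W.η x)))

/-- The tangential derivative of the dynamic boundary condition. -/
theorem surface_identity (hL : 0 < L) (x : ℝ) :
    (W.u (x, W.η x) ^ 2 - W.v (x, W.η x) ^ 2) * pdX W.u (x, W.η x) +
      W.v (x, W.η x) * W.surfaceQ x = 0 := by
  have hP := (W.hasDerivAt_surface (W.P_smooth.differentiable (by norm_num)) x).unique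
    ((hasDerivAt_const x Patm).congr_of_eventuallyEq
      (Filter.Eventually.of_forall W.surface_pressure))
  have h1 := W.euler_x_surface hL x
  have h2 := W.euler_y_surface hL x
  have h3 := W.surface_kinematic x
  have h4 := W.incompressible_closure hL (W.neg_depth_lt_η hL x).le (le_refl (W.η x))
  have h5 : pdY W.v (x, W.η x) = -pdX W.u (x, W.η x) := by linarith
  rw [h5] at h2
  unfold surfaceQ
  generalize W.u (x, W.η x) = a at *
  generalize W.v (x, W.η x) = b at *
  generalize deriv W.η x = s at *
  subst h3
  linear_combination a * h1 + s * a * h2 - a * hP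

theorem hasDerivAt_surfaceQ (hL : 0 < L) (x : ℝ) :
    HasDerivAt W.surfaceQ (W.surfaceG x / W.u (x, W.η x)) x := by
  have h := ((W.hasDerivAt_surface W.differentiable_u x).fun_mul
    ((W.hasDerivAt_surface W.differentiable_uy x).fun_add
      (W.hasDerivAt_surface W.differentiable_vx x))).const_add g
  have hu := (W.u_surface_neg hL x).ne
  have h1 := W.second_order_div_x_surface hL x
  have h2 := W.second_order_vort_x_surface hL x
  have h3 := W.second_order_vort_y_surface hL x
  refine h.congr_deriv ?_
  rw [ux_comm, eq_div_iff hu, surfaceG]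
  have h4 := W.surface_kinematic x
  have h5 : pdY (pdX W.v) (x, W.η x) = -pdX (pdX W.u) (x, W.η x) := by linarith
  rw [h5] at h3 ⊢
  have h6 : pdX (pdX W.v) (x, W.η x) =
    pdY (pdX W.u) (x, W.η x) - W.dγ 0 * W.v (x, W.η x) := by linarith
  have h7 : pdY (pdY W.u) (x, W.η x) =
    -pdX (pdX W.u) (x, W.η x) - W.dγ 0 * W.u (x, W.η x) := by linarith
  rw [h6, h7, h4]
  ring

theorem deriv_η_trough (hL : 0 < L) : deriv W.η L = 0 := by
  have h := W.surface_kinematic L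
  rw [v_trough_line] at h
  exact (mul_eq_zero.1 h.symm).resolve_right (W.u_surface_neg hL L).ne

theorem surfaceG_crest : W.surfaceG 0 = 0 := by
  simp [surfaceG, v_crest_line, ux_crest_line, uxy_crest_line]

variable {W}

/-- The derivative of `surface_identity` at a point of the surface where `u_x` vanishes. -/
theorem surface_identity_deriv (hL : 0 < L) {x : ℝ} (h : pdX W.u (x, W.η x) = 0) :
    (W.u (x, W.η x) ^ 2 - W.v (x, W.η x) ^ 2) *
        (pdX (pdX W.u) (x, W.η x) + deriv W.η x * pdY (pdX W.u) (x, W.η x)) +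
      ((pdX W.v (x, W.η x) + deriv W.η x * pdY W.v (x, W.η x)) * W.surfaceQ x +
        W.v (x, W.η x) * (W.surfaceG x / W.u (x, W.η x))) = 0 := by
  have hu := W.hasDerivAt_surface W.differentiable_u x
  have hv := W.hasDerivAt_surface W.differentiable_v x
  have hux := W.hasDerivAt_surface W.differentiable_ux x
  have hF := ((((hu.fun_pow 2).fun_sub (hv.fun_pow 2)).fun_mul hux).fun_add
    (hv.fun_mul (W.hasDerivAt_surfaceQ hL x))).unique
    ((hasDerivAt_const x (0 : ℝ)).congr_of_eventuallyEq
      (Filter.Eventually.of_forall (W.surface_identity hL)))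
  rw [h, mul_zero, zero_add] at hF
  exact hF

theorem uy_pos_of_surfaceQ_eq_zero (hL : 0 < L) (hg : 0 < g) (hW : W.MemW) {x : ℝ}
    (h : W.surfaceQ x = 0) :
    0 < pdY W.u (x, W.η x) + pdX W.v (x, W.η x) ∧ 0 < pdY W.u (x, W.η x) := by
  have hu := W.u_surface_neg hL x
  have h1 : 0 < pdY W.u (x, W.η x) + pdX W.v (x, W.η x) := by
    unfold surfaceQ at h
    by_contra! h2
    nlinarith [mul_nonneg_of_nonpos_of_nonpos hu.le h2]
  have h2 := hW.1 0 ⟨le_rfl, W.m_pos.le⟩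
  have h3 := W.vorticity_surface hL x
  exact ⟨h1, by linarith⟩

theorem MonotoneHalf.v_surface_nonneg (hL : 0 < L) (hm : W.MonotoneHalf) {x : ℝ} (h0 : 0 ≤ x)
    (h1 : x ≤ L) : 0 ≤ W.v (x, W.η x) :=
  hm.v_nonneg ⟨h0, h1, (W.neg_depth_lt_η hL x).le, le_rfl⟩

theorem MonotoneHalf.v_surface_pos (hm : W.MonotoneHalf) {x : ℝ} (h0 : 0 < x)
    (h1 : x < L) : 0 < W.v (x, W.η x) :=
  hm _ (Or.inr ⟨h0, h1, rfl⟩)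

theorem MonotoneHalf.vx_crest_nonneg (hL : 0 < L) (hm : W.MonotoneHalf) :
    0 ≤ pdX W.v (0, W.η 0) := by
  have h := (W.hasDerivAt_surface W.differentiable_v 0).fun_neg
  rw [W.deriv_η_zero, zero_mul, add_zero] at h
  have := h.nonpos_of_le_right hL (fun t h1 h2 => by
    rw [v_crest_line]
    linarith [hm.v_surface_nonneg hL h1.le h2])
  linarith

theorem MonotoneHalf.vx_trough_nonpos (hL : 0 < L) (hm : W.MonotoneHalf) :
    pdX W.v (L, W.η L) ≤ 0 := by
  have h := (W.hasDerivAt_surface W.differentiable_v L).fun_neg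
  rw [W.deriv_η_trough hL, zero_mul, add_zero] at h
  have := h.nonneg_of_le_left hL (fun t h1 h2 => by
    rw [v_trough_line]
    linarith [hm.v_surface_nonneg hL h1 h2.le])
  linarith

theorem surfaceQ_trough_pos (hL : 0 < L) (hm : W.MonotoneHalf)
    (ht : 0 < g - W.γ 0 * W.u (L, W.η L)) : 0 < W.surfaceQ L := by
  have h1 := W.vorticity_surface hL L
  have h2 := mul_nonneg_of_nonpos_of_nonpos (W.u_surface_neg hL L).le
    (hm.vx_trough_nonpos hL)
  have h3 : pdY W.u (L, W.η L) = pdX W.v (L, W.η L) - W.γ 0 := by linarith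
  rw [surfaceQ, h3]
  linarith

theorem hasDerivAt_surfaceG_crest (h : pdX (pdX W.u) (0, W.η 0) = 0) :
    HasDerivAt W.surfaceG
      (pdX W.v (0, W.η 0) * pdY W.u (0, W.η 0) *
          (pdY W.u (0, W.η 0) + pdX W.v (0, W.η 0)) +
        2 * W.u (0, W.η 0) * (W.u (0, W.η 0) * pdY (pdX (pdX W.u)) (0, W.η 0) -
          W.dγ 0 * (W.u (0, W.η 0) * pdX W.v (0, W.η 0)))) 0 := by
  have hu := W.hasDerivAt_surface W.differentiable_u 0
  have hv := W.hasDerivAt_surface W.differentiable_v 0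
  have hux := W.hasDerivAt_surface W.differentiable_ux 0
  have huy := W.hasDerivAt_surface W.differentiable_uy 0
  have hvx := W.hasDerivAt_surface W.differentiable_vx 0
  have huxy := W.hasDerivAt_surface
    ((contDiff_one_pdY W.contDiff_ux).differentiable one_ne_zero) 0
  have huxx := W.hasDerivAt_surface
    ((contDiff_one_pdX W.contDiff_ux).differentiable one_ne_zero) 0
  refine HasDerivAt.congr_deriv ((((hu.fun_mul hux).fun_add (hv.fun_mul huy)).fun_mul
    (huy.fun_add hvx)).fun_add ((hu.const_mul 2).fun_mul (((hu.fun_mul huxy).fun_sub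
      (hv.fun_mul huxx)).fun_sub ((hu.fun_mul hv).const_mul (W.dγ 0))))) ?_
  simp only [v_crest_line, ux_crest_line, uxy_crest_line, deriv_η_zero, h,
    pdY_pdX_comm W.contDiff_ux]
  ring

end surface

theorem ux_surface_neg {W : PeriodicWave g Patm L} (hL : 0 < L) (hg : 0 < g) (hW : W.MemW)
    (hm : W.MonotoneHalf) (hux : ∀ x, 0 ≤ x → x ≤ L → pdX W.u (x, W.η x) ≤ 0)
    {x : ℝ} (h0 : 0 < x) (h1 : x < L) : pdX W.u (x, W.η x) < 0 := by
  refine lt_of_le_of_ne (hux x h0.le h1.le) fun h => ?_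
  have hv := hm.v_surface_pos h0 h1
  have hu := W.u_surface_neg hL x
  have hQ : W.surfaceQ x = 0 := by
    have := W.surface_identity hL x
    rw [h, mul_zero, zero_add] at this
    exact (mul_eq_zero.1 this).resolve_left hv.ne'
  have hd : pdX (pdX W.u) (x, W.η x) + deriv W.η x * pdY (pdX W.u) (x, W.η x) = 0 := by
    refine IsLocalMax.hasDerivAt_eq_zero ?_ (W.hasDerivAt_surface W.differentiable_ux x)
    filter_upwards [Ioo_mem_nhds h0 h1] with t ht
    rw [h]
    exact hux t ht.1.le ht.2.le
  have hG : W.surfaceG x = 0 := by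
    have := surface_identity_deriv (W := W) hL h
    rw [hd, hQ, mul_zero, mul_zero, zero_add, zero_add] at this
    have := (mul_eq_zero.1 this).resolve_left hv.ne'
    exact (div_eq_zero_iff.1 this).resolve_right hu.ne
  obtain ⟨hq1, hq2⟩ := uy_pos_of_surfaceQ_eq_zero hL hg hW hQ
  have hopf := mul_pos (neg_pos.2 hu) (hopf_surface hL hW hm hux h0 h1 h)
  have hk := W.surface_kinematic x
  have e1 : 0 < W.u (x, W.η x) * (W.u (x, W.η x) * pdY (pdX W.u) (x, W.η x) -
      W.v (x, W.η x) * pdX (pdX W.u) (x, W.η x)) := by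
    apply mul_pos_of_neg_of_neg hu
    rw [hk]; linarith
  have e2 : 0 ≤ -W.dγ 0 * (W.u (x, W.η x) ^ 2 * W.v (x, W.η x)) :=
    mul_nonneg (by linarith [W.dγ_nonpos hW 0]) (by positivity)
  have e3 := mul_pos (mul_pos hv hq2) hq1
  rw [surfaceG, h] at hG
  linarith

theorem surfaceQ_crest_ne_zero {W : PeriodicWave g Patm L} (hL : 0 < L) (hg : 0 < g) (hW : W.MemW)
    (hm : W.MonotoneHalf) (hux : ∀ x, 0 ≤ x → x ≤ L → pdX W.u (x, W.η x) ≤ 0)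
    (hQ : ∀ x, 0 ≤ x → x ≤ L → 0 ≤ W.surfaceQ x) :
    W.surfaceQ 0 ≠ 0 := by
  intro h
  have hu := W.u_surface_neg hL 0
  have huxx : pdX (pdX W.u) (0, W.η 0) = 0 := by
    have := surface_identity_deriv (W := W) hL (W.ux_crest_line (W.η 0))
    rw [h, v_crest_line, deriv_η_zero] at this
    simpa [hu.ne] using this
  obtain ⟨hq1, hq2⟩ := uy_pos_of_surfaceQ_eq_zero hL hg hW h
  have hvx := hm.vx_crest_nonneg hL
  have huxxy := uxxy_crest_pos hL hW hm hux huxx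
  have hG := hasDerivAt_surfaceG_crest huxx
  set G' := pdX W.v (0, W.η 0) * pdY W.u (0, W.η 0) *
          (pdY W.u (0, W.η 0) + pdX W.v (0, W.η 0)) +
        2 * W.u (0, W.η 0) * (W.u (0, W.η 0) * pdY (pdX (pdX W.u)) (0, W.η 0) -
          W.dγ 0 * (W.u (0, W.η 0) * pdX W.v (0, W.η 0))) with hG'
  have hpos : 0 < G' := by
    have e1 := mul_nonneg (mul_nonneg hvx hq2.le) hq1.le
    have e2 := mul_pos (pow_pos (neg_pos.2 hu) 2) huxxy
    have e3 : 0 ≤ -W.dγ 0 * (W.u (0, W.η 0) ^ 2 * pdX W.v (0, W.η 0)) :=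
      mul_nonneg (by linarith [W.dγ_nonpos hW 0]) (by positivity)
    rw [hG']
    linarith
  have ht := (hasDerivAt_iff_tendsto_slope.1 hG).mono_left
    (nhdsWithin_mono 0 (show Ioi (0 : ℝ) ⊆ {0}ᶜ from fun t ht => ne_of_gt ht))
  obtain ⟨ε, hε, hεG⟩ := mem_nhdsGT_iff_exists_Ioo_subset.1 (ht.eventually_const_lt hpos)
  rw [mem_Ioi] at hε
  set r := min (ε / 2) L with hr
  have hr0 : 0 < r := by positivity
  obtain ⟨z, hz, he⟩ := exists_hasDerivAt_eq_slope W.surfaceQ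
    (fun s => W.surfaceG s / W.u (s, W.η s)) hr0
    (fun s _ => (W.hasDerivAt_surfaceQ hL s).continuousAt.continuousWithinAt)
    (fun s _ => W.hasDerivAt_surfaceQ hL s)
  have hz1 : 0 < W.surfaceG z := by
    have : 0 < slope W.surfaceG 0 z :=
      hεG ⟨hz.1, by linarith [hz.2, min_le_left (ε / 2) L]⟩
    rw [slope_def_field, W.surfaceG_crest, sub_zero, sub_zero] at this
    exact (div_pos_iff_of_pos_right hz.1).1 this
  have hz2 := div_neg_of_pos_of_neg hz1 (W.u_surface_neg hL z)
  have hz3 : 0 ≤ (W.surfaceQ r - W.surfaceQ 0) / (r - 0) := by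
    rw [h, sub_zero, sub_zero]
    exact div_nonneg (hQ r hr0.le (min_le_right _ _)) hr0.le
  linarith

theorem surface_slope_lt {W : PeriodicWave g Patm L} (hL : 0 < L) (hg : 0 < g) (hW : W.MemW)
    (hm : W.MonotoneHalf) (hux : ∀ x, 0 ≤ x → x ≤ L → pdX W.u (x, W.η x) ≤ 0)
    (hv : ∀ x, 0 ≤ x → x ≤ L → |W.v (x, W.η x)| ≤ |W.u (x, W.η x)|)
    {x : ℝ} (h0 : 0 ≤ x) (h1 : x ≤ L) : |W.v (x, W.η x)| < |W.u (x, W.η x)| := by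
  have hu := W.u_surface_neg hL
  rcases h0.eq_or_lt with rfl | h0'
  · rw [v_crest_line, abs_zero]; exact abs_pos.2 (hu _).ne
  rcases h1.eq_or_lt with rfl | h1'
  · rw [v_trough_line, abs_zero]; exact abs_pos.2 (hu _).ne
  refine lt_of_le_of_ne (hv x h0 h1) fun h => ?_
  rw [abs_of_pos (hm.v_surface_pos h0' h1'), abs_of_neg (hu x)] at h
  have hd := IsLocalMax.hasDerivAt_eq_zero (f := fun s => W.u (s, W.η s) + W.v (s, W.η s)) (a := x)
    (by
      filter_upwards [Ioo_mem_nhds h0' h1'] with t ht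
      have := hv t ht.1.le ht.2.le
      rw [abs_of_pos (hm.v_surface_pos ht.1 ht.2), abs_of_neg (hu t)] at this
      linarith)
    ((W.hasDerivAt_surface W.differentiable_u x).fun_add (W.hasDerivAt_surface W.differentiable_v x))
  have h2 := W.surface_kinematic x
  have h3 := W.incompressible_closure hL (W.neg_depth_lt_η hL x).le (le_refl (W.η x))
  have h4 := W.vorticity_surface hL x
  have h5 := hW.1 0 ⟨le_rfl, W.m_pos.le⟩
  have h6 := ux_surface_neg hL hg hW hm hux h0' h1'
  have h7 : deriv W.η x = -1 := by
    have : (deriv W.η x + 1) * W.u (x, W.η x) = 0 := by linarith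
    linarith [(mul_eq_zero.1 this).resolve_right (hu x).ne]
  rw [h7] at hd
  linarith

theorem surfaceQ_pos {W : PeriodicWave g Patm L} (hL : 0 < L) (hg : 0 < g) (hW : W.MemW)
    (hm : W.MonotoneHalf) (hux : ∀ x, 0 ≤ x → x ≤ L → pdX W.u (x, W.η x) ≤ 0)
    (ht : 0 < g - W.γ 0 * W.u (L, W.η L))
    (hv : ∀ x, 0 ≤ x → x ≤ L → |W.v (x, W.η x)| ≤ |W.u (x, W.η x)|)
    (hQ : ∀ x, 0 ≤ x → x ≤ L → 0 ≤ W.surfaceQ x) {x : ℝ} (h0 : 0 ≤ x) (h1 : x ≤ L) :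
    0 < W.surfaceQ x := by
  rcases h0.eq_or_lt with rfl | h0'
  · exact lt_of_le_of_ne (hQ 0 le_rfl hL.le) (surfaceQ_crest_ne_zero hL hg hW hm hux hQ).symm
  rcases h1.eq_or_lt with rfl | h1'
  · exact surfaceQ_trough_pos hL hm ht
  have h2 := sq_lt_sq.2 (surface_slope_lt hL hg hW hm hux hv h0 h1)
  have h3 := mul_neg_of_pos_of_neg (sub_pos.2 h2) (ux_surface_neg hL hg hW hm hux h0' h1')
  have h4 : 0 < W.v (x, W.η x) * W.surfaceQ x := by
    linarith [W.surface_identity hL x]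
  exact (pos_iff_pos_of_mul_pos h4).1 (hm.v_surface_pos h0' h1')

/-- If `|v| < |u|` and `g + u (u_y + v_x) > 0` on the surface, then `u_x ≤ 0` there. -/
theorem ux_surface_nonpos {W : PeriodicWave g Patm L} (hL : 0 < L) (hW : W.MemW) {x : ℝ}
    (h0 : 0 ≤ x) (h1 : x ≤ L) (hv : |W.v (x, W.η x)| < |W.u (x, W.η x)|)
    (hQ : 0 < W.surfaceQ x) : pdX W.u (x, W.η x) ≤ 0 := by
  have hv0 : 0 ≤ W.v (x, W.η x) := by
    rcases hW.2.2.2 with h | h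
    · exact (h.1 _).ge
    · exact h.v_surface_nonneg hL h0 h1
  by_contra! h
  have h2 := mul_pos (sub_pos.2 (sq_lt_sq.2 hv)) h
  linarith [W.surface_identity hL x, mul_nonneg hv0 hQ.le]

theorem IsTrivial.surfaceQ_pos {W : PeriodicWave g Patm L} (h : W.IsTrivial) (hL : 0 < L)
    (ht : 0 < g - W.γ 0 * W.u (L, W.η L)) (x : ℝ) : 0 < W.surfaceQ x := by
  obtain ⟨hv, hη, hu, -⟩ := h
  have h1 := W.vorticity_surface hL x
  have h2 : pdX W.v (x, W.η x) = 0 := by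
    have : W.v = fun _ => 0 := funext hv
    rw [this]; simp [pdX]
  rw [h2] at h1
  rw [hη, hu L x] at ht
  rw [surfaceQ, h2, show pdY W.u (x, W.η x) = -W.γ 0 by linarith, hη]
  linarith

/-- The bound `|v| < |u|` propagates from the free surface to the fluid domain. -/
theorem MonotoneHalf.slope_lt {W : PeriodicWave g Patm L} (hm : W.MonotoneHalf) (hL : 0 < L)
    (hW : W.MemW) (hv : ∀ x, 0 ≤ x → x ≤ L → |W.v (x, W.η x)| < |W.u (x, W.η x)|) :
    ∀ p ∈ W.halfBar, |W.v p| < |W.u p| := by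
  obtain ⟨M, hM⟩ := W.exists_coeff_bound hL
  have hbd : ∀ p ∈ W.halfBar \ W.Ωplus, W.u p + W.v p < 0 := by
    rintro ⟨x, y⟩ hp
    have hu := W.u_neg hp.1.2.2.1 hp.1.2.2.2
    rcases W.boundary_cases hp with rfl | rfl | rfl | rfl
    · rw [v_crest_line]; simpa using hu
    · rw [v_trough_line]; simpa using hu
    · rw [W.bed_kinematic]; simpa using hu
    · have := hv x hp.1.1 hp.1.2.1
      rw [abs_of_neg hu] at this
      linarith [le_abs_self (W.v (x, W.η x))]
  have hin := neg_of_neg_boundary (f := fun p => W.u p + W.v p) (W.isCompact_halfBar hL)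
    W.isOpen_Ωplus W.Ωplus_subset_halfBar (W.contDiff_two_u.add W.contDiff_two_v)
    (fun p _ => W.coeff_nonpos hW p) (fun p hp => hM p (W.Ωplus_subset_halfBar hp))
    (fun p hp => by
      obtain ⟨x, y⟩ := p
      have h := lap_add_const_mul W.contDiff_two_u W.contDiff_two_v 1 (x, y)
      simp only [one_mul] at h
      rw [h, lap_u hp.2.2.1 hp.2.2.2, lap_v hp.2.2.1 hp.2.2.2]
      linarith) hbd
  rintro ⟨x, y⟩ hp
  have h : W.u (x, y) + W.v (x, y) < 0 := by
    by_cases hU : (x, y) ∈ W.Ωplus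
    · exact hin _ hU
    · exact hbd _ ⟨hp, hU⟩
  rw [abs_of_nonneg (hm.v_nonneg hp), abs_of_neg (W.u_neg hp.2.2.1 hp.2.2.2)]
  linarith

theorem continuous_trace (W : PeriodicWave g Patm L) : Continuous W.trace := by
  have hη : Continuous fun x => (x, W.η x) := by
    have := W.η_smooth.continuous
    fun_prop
  have h1 := W.u_smooth.continuous.comp hη
  have h2 := W.v_smooth.continuous.comp hη
  have h3 := W.contDiff_ux.continuous.comp hη
  have h4 := W.contDiff_vx.continuous.comp hη
  have h5 := W.contDiff_uy.continuous.comp hη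
  have h6 := (contDiff_one_pdX W.contDiff_ux).continuous.comp hη
  have h7 := (contDiff_one_pdY W.contDiff_ux).continuous.comp hη
  exact h1.prodMk (h2.prodMk (h3.prodMk (h4.prodMk (h5.prodMk (h6.prodMk h7)))))

end PeriodicWave

theorem IsPreconnected.subset_of_isOpen_isClosed {X : Type*} [TopologicalSpace X] {T O B : Set X}
    (hT : IsPreconnected T) (hO : IsOpen O) (hB : IsClosed B) (hOB : T ∩ O ⊆ B)
    (hBO : T ∩ B ⊆ O) (hne : (T ∩ O).Nonempty) : T ⊆ O := by
  intro f hf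
  by_contra hfO
  obtain ⟨z, hz, hz1, hz2⟩ := hT O Bᶜ hO hB.isOpen_compl
    (fun x hx => (em (x ∈ B)).imp (fun h => hBO ⟨hx, h⟩) id) hne
    ⟨f, hf, fun h => hfO (hBO ⟨hf, h⟩)⟩
  exact hz2 (hOB ⟨hz, hz1⟩)

/-- **Theorem (bound on the slope, periodic case).**  Let `𝓜 ⊆ 𝒲` be a set of periodic
waves whose trace image `τ(𝓜)` is a connected subset of `C([0,L], ℝ⁷)`.  If `𝓜` contains
a trivial wave and every wave of `𝓜` satisfies `g - γ(0) u > 0` at the trough `(L, η L)`,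
then every streamline of every wave of `𝓜` has slope `|v/u| < 1`. -/
theorem periodic_slope_lt_one (g Patm L : ℝ) (hg : 0 < g) (hL : 0 < L)
    (M : Set (PeriodicWave g Patm L))
    (hMW : ∀ W ∈ M, W.MemW)
    (hconn : IsConnected {f : C(↥(Set.Icc (0:ℝ) L), ℝ × ℝ × ℝ × ℝ × ℝ × ℝ × ℝ) |
      ∃ W ∈ M, ∀ x : ↥(Set.Icc (0:ℝ) L), f x = W.trace x.1})
    (htriv : ∃ W ∈ M, W.IsTrivial)
    (htrough : ∀ W ∈ M, 0 < g - W.γ 0 * W.u (L, W.η L)) :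
    ∀ W ∈ M, ∀ p ∈ W.Ωbar, |W.v p| < |W.u p| := by
  set T := {f : C(↥(Set.Icc (0:ℝ) L), ℝ × ℝ × ℝ × ℝ × ℝ × ℝ × ℝ) |
      ∃ W ∈ M, ∀ x : ↥(Set.Icc (0:ℝ) L), f x = W.trace x.1} with hT
  let U : Set (ℝ × ℝ × ℝ × ℝ × ℝ × ℝ × ℝ) :=
    {a | |a.2.1| < |a.1| ∧ 0 < g + a.1 * (a.2.2.2.2.1 + a.2.2.2.1)}
  let A : Set (ℝ × ℝ × ℝ × ℝ × ℝ × ℝ × ℝ) :=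
    {a | |a.2.1| ≤ |a.1| ∧ a.2.2.1 ≤ 0 ∧ 0 ≤ g + a.1 * (a.2.2.2.2.1 + a.2.2.2.1)}
  have hq : Continuous fun a : ℝ × ℝ × ℝ × ℝ × ℝ × ℝ × ℝ =>
    g + a.1 * (a.2.2.2.2.1 + a.2.2.2.1) := by fun_prop
  have h1 : Continuous fun a : ℝ × ℝ × ℝ × ℝ × ℝ × ℝ × ℝ => |a.1| := by fun_prop
  have h2 : Continuous fun a : ℝ × ℝ × ℝ × ℝ × ℝ × ℝ × ℝ => |a.2.1| := by fun_prop
  have h3 : Continuous fun a : ℝ × ℝ × ℝ × ℝ × ℝ × ℝ × ℝ => a.2.2.1 := by fun_prop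
  have hU : IsOpen U := (isOpen_lt h2 h1).inter (isOpen_lt continuous_const hq)
  have hA : IsClosed A := (isClosed_le h2 h1).inter
    ((isClosed_le h3 continuous_const).inter (isClosed_le continuous_const hq))
  have key : T ⊆ {f | MapsTo f univ U} := by
    refine IsPreconnected.subset_of_isOpen_isClosed (B := {f | ∀ x, f x ∈ A})
      hconn.isPreconnected (ContinuousMap.isOpen_setOfPred_mapsTo isCompact_univ hU) ?_ ?_ ?_ ?_
    · rw [ofPred_forall]
      exact isClosed_iInter fun x => hA.preimage (continuous_eval_const x)
    · rintro f ⟨⟨W, hWM, hf⟩, hfU⟩ x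
      have h := hfU (mem_univ x)
      rw [hf x] at h ⊢
      exact ⟨h.1.le, PeriodicWave.ux_surface_nonpos hL (hMW W hWM) x.2.1 x.2.2 h.1 h.2, h.2.le⟩
    · rintro f ⟨⟨W, hWM, hf⟩, hfA⟩ x -
      have h : ∀ s, 0 ≤ s → s ≤ L → W.trace s ∈ A := fun s h0 h1 => by
        have := hfA ⟨s, h0, h1⟩
        rwa [hf] at this
      rw [hf x]
      rcases (hMW W hWM).2.2.2 with ht | hm
      · refine ⟨?_, ht.surfaceQ_pos hL (htrough W hWM) x⟩
        change |W.v _| < |W.u _|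
        rw [ht.1, abs_zero]
        exact abs_pos.2 (W.u_surface_neg hL _).ne
      · exact ⟨PeriodicWave.surface_slope_lt hL hg (hMW W hWM) hm (fun s h0 h1 => (h s h0 h1).2.1)
          (fun s h0 h1 => (h s h0 h1).1) x.2.1 x.2.2,
          PeriodicWave.surfaceQ_pos hL hg (hMW W hWM) hm (fun s h0 h1 => (h s h0 h1).2.1)
          (htrough W hWM) (fun s h0 h1 => (h s h0 h1).1) (fun s h0 h1 => (h s h0 h1).2.2)
          x.2.1 x.2.2⟩
    · obtain ⟨W, hWM, ht⟩ := htriv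
      refine ⟨⟨fun x => W.trace x.1, W.continuous_trace.comp continuous_subtype_val⟩,
        ⟨W, hWM, fun _ => rfl⟩, fun x _ => ⟨?_, ht.surfaceQ_pos hL (htrough W hWM) x⟩⟩
      change |W.v _| < |W.u _|
      rw [ht.1, abs_zero]
      exact abs_pos.2 (W.u_surface_neg hL _).ne
  intro W hWM
  rcases (hMW W hWM).2.2.2 with ht | hm
  · rintro ⟨x, y⟩ hp
    rw [ht.1, abs_zero]
    exact abs_pos.2 (W.u_neg hp.2.2.1 hp.2.2.2).ne
  have hs : ∀ x, 0 ≤ x → x ≤ L → |W.v (x, W.η x)| < |W.u (x, W.η x)| := fun x h0 h1 =>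
    (key (a := ⟨fun x => W.trace x.1, W.continuous_trace.comp continuous_subtype_val⟩)
      ⟨W, hWM, fun _ => rfl⟩ (mem_univ (⟨x, h0, h1⟩ : Set.Icc (0:ℝ) L))).1
  have hhalf := hm.slope_lt hL (hMW W hWM) hs
  rintro ⟨x, y⟩ ⟨h1, h2, h3, h4⟩
  simp only at h1 h2 h3 h4
  rcases le_total 0 x with h | h
  · exact hhalf _ ⟨h, h2, h3, h4⟩
  · have := hhalf (-x, y) ⟨by simp only; linarith, by simp only; linarith, h3,
      by simp only; rwa [W.η_even]⟩
    rwa [W.v_odd, W.u_even, abs_neg] at this
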